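/- arXiv:1212.1426 — 3 statements merged into one kernel-verified Lean document; each statement's English description precedes it below -/
import Mathlib

section
/- Let n ≥ 3 and let a, b, c be integers with 1 ≤ a < b < c ≤ n. Let B_n^{a,b,c} be the (n−2)×(n−2) integer matrix obtained from B_n by deleting the three columns indexed by a, b and c. Then det(B_n^{a,b,c}) = (−1)^{a+b+c}·(a−b)·(a−c)·(b−c). -/
/-- The `(n-2) × (n+1)` integer matrix `B_n`, with rows indexed by
`i ∈ {1,…,n-2}` (a row index `i : Fin (n-2)` represents `i+1`) and columns
indexed by `j ∈ {0,…,n}`: the row corresponding to `i` has entry `-2` in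
column `0`, `1` in column `i`, `-2` in column `i+1` and `1` in column `i+2`,
and `0` elsewhere. -/
def buchiB (n : ℕ) : Matrix (Fin (n - 2)) (Fin (n + 1)) ℤ :=
  Matrix.of fun i j =>
    if (j : ℕ) = 0 then -2
    else if (j : ℕ) = (i : ℕ) + 1 then 1
    else if (j : ℕ) = (i : ℕ) + 2 then -2
    else if (j : ℕ) = (i : ℕ) + 3 then 1
    else 0

theorem buchi_kernel (n : ℕ) (hn : 3 ≤ n) (p q : ℤ) (i : Fin (n - 2)) :
    ∑ j : Fin (n + 1), (if (j : ℕ) = 0 then (1 : ℤ) else ((j : ℤ) - p) * ((j : ℤ) - q)) *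
      buchiB n i j = 0 := by
  have hi := i.isLt
  have h : ∀ j : Fin (n + 1),
      (if (j : ℕ) = 0 then (1 : ℤ) else ((j : ℤ) - p) * ((j : ℤ) - q)) * buchiB n i j =
      (if j = (⟨0, by omega⟩ : Fin (n + 1)) then -2 else 0)
      + (if j = (⟨i + 1, by omega⟩ : Fin (n + 1)) then ((i : ℤ) + 1 - p) * ((i : ℤ) + 1 - q) else 0)
      + (if j = (⟨i + 2, by omega⟩ : Fin (n + 1)) then
          -2 * (((i : ℤ) + 2 - p) * ((i : ℤ) + 2 - q)) else 0)
      + (if j = (⟨i + 3, by omega⟩ : Fin (n + 1)) then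
          ((i : ℤ) + 3 - p) * ((i : ℤ) + 3 - q) else 0) := by
    rintro ⟨j, hj⟩
    simp only [buchiB, Matrix.of_apply, Fin.mk.injEq]
    by_cases h0 : j = 0
    · subst h0; simp
    by_cases h1 : j = i + 1
    · subst h1; simp
    by_cases h2 : j = i + 2
    · subst h2; simp; ring
    by_cases h3 : j = i + 3
    · subst h3; simp
    simp [h0, h1, h2, h3]
  rw [Finset.sum_congr rfl (fun j _ => h j)]
  simp only [Finset.sum_add_distrib, Finset.sum_ite_eq', Finset.mem_univ, if_true]
  ring

theorem buchi_step (n : ℕ) (hn : 3 ≤ n) (p q r : ℕ)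
    (hr1 : 1 ≤ r) (hrn : r + 1 ≤ n) (hp : 1 ≤ p) (hq : 1 ≤ q) (hrp : r ≠ p) (hrq : r ≠ q)
    (hrp' : r + 1 ≠ p) (hrq' : r + 1 ≠ q) (hpq : p ≠ q) (hpn : p ≤ n) (hqn : q ≤ n)
    (f : Fin (n - 2) → Fin (n + 1)) (hf : StrictMono f)
    (hrange : ∀ j : Fin (n + 1),
      j ∈ Set.range f ↔ ((j : ℕ) ≠ p ∧ (j : ℕ) ≠ q ∧ (j : ℕ) ≠ r + 1)) :
    ∃ f' : Fin (n - 2) → Fin (n + 1), StrictMono f' ∧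
      (∀ j : Fin (n + 1),
        j ∈ Set.range f' ↔ ((j : ℕ) ≠ p ∧ (j : ℕ) ≠ q ∧ (j : ℕ) ≠ r)) ∧
      (((r : ℤ) + 1 - p) * ((r : ℤ) + 1 - q)) * ((buchiB n).submatrix id f').det =
        - ((((r : ℤ) - p) * ((r : ℤ) - q)) * ((buchiB n).submatrix id f).det) := by
  obtain ⟨k, hk⟩ := (hrange ⟨r, by omega⟩).2 ⟨hrp, hrq, by simp⟩
  let s : Fin (n + 1) := ⟨r + 1, by omega⟩
  have hkv : (f k : ℕ) = r := by rw [hk]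
  have hne : ∀ i, (f i : ℕ) ≠ r + 1 := fun i => ((hrange (f i)).1 ⟨i, rfl⟩).2.2
  refine ⟨Function.update f k s, ?_, ?_, ?_⟩
  · intro i j hij
    rw [Fin.lt_def]
    have h1 : (f i : ℕ) < f j := hf hij
    have := hne i
    have := hne j
    by_cases hi : i = k
    · subst hi
      rw [Function.update_self, Function.update_of_ne hij.ne']
      simp only [s]; omega
    · rw [Function.update_of_ne hi]
      by_cases hj : j = k
      · subst hj
        rw [Function.update_self]; simp only [s]; omega
      · rwa [Function.update_of_ne hj]
  · intro j
    constructor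
    · rintro ⟨i, rfl⟩
      by_cases hi : i = k
      · subst hi
        rw [Function.update_self]; simp only [s]; omega
      · rw [Function.update_of_ne hi]
        have h1 := (hrange (f i)).1 ⟨i, rfl⟩
        refine ⟨h1.1, h1.2.1, fun h => hi (hf.injective (Fin.ext ?_))⟩
        omega
    · rintro ⟨h1, h2, h3⟩
      by_cases hj : (j : ℕ) = r + 1
      · exact ⟨k, by rw [Function.update_self]; exact Fin.ext hj.symm⟩
      · obtain ⟨i, hi⟩ := (hrange j).2 ⟨h1, h2, hj⟩
        refine ⟨i, ?_⟩
        rw [Function.update_of_ne, hi]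
        rintro rfl
        apply h3; rw [← hi, hkv]
  · set x : Fin (n + 1) → ℤ := fun j =>
      if (j : ℕ) = 0 then (1 : ℤ) else ((j : ℤ) - p) * ((j : ℤ) - q) with hx
    set A := (buchiB n).submatrix id f with hA
    have hker : ∀ i, x s * buchiB n i s = ∑ l, (- x (f l)) * A i l := by
      intro i
      have h := buchi_kernel n hn p q i
      change ∑ j, x j * buchiB n i j = 0 at h
      have hsub : ∑ j ∈ insert s (Finset.univ.image f), x j * buchiB n i j
          = ∑ j, x j * buchiB n i j := by
        apply Finset.sum_subset (Finset.subset_univ _)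
        intro j _ hj
        simp only [Finset.mem_insert, Finset.mem_image, Finset.mem_univ, true_and, not_or] at hj
        have h1 : ¬ ((j : ℕ) ≠ p ∧ (j : ℕ) ≠ q ∧ (j : ℕ) ≠ r + 1) := fun h => hj.2 ((hrange j).2 h)
        have h2 : (j : ℕ) ≠ r + 1 := fun h => hj.1 (Fin.ext h)
        have h3 : (j : ℕ) = p ∨ (j : ℕ) = q := by omega
        have h4 : (j : ℕ) ≠ 0 := by omega
        have : x j = 0 := by
          simp only [hx, h4, if_false]
          rcases h3 with h3 | h3 <;> simp [h3]
        rw [this, zero_mul]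
      rw [h, Finset.sum_insert, Finset.sum_image (fun a _ b _ hab => hf.injective hab)] at hsub
      · simp only [neg_mul, Finset.sum_neg_distrib, hA, Matrix.submatrix_apply, id]
        linarith
      · simp only [Finset.mem_image, Finset.mem_univ, true_and, not_exists]
        intro l hl
        exact hne l (by rw [hl])
    have hupd : (buchiB n).submatrix id (Function.update f k s) =
        A.updateCol k (fun i => buchiB n i s) := by
      ext i l
      by_cases hl : l = k
      · subst hl; simp
      · simp [hl, hA]
    have hxs : x s = ((r : ℤ) + 1 - p) * ((r : ℤ) + 1 - q) := by
      simp [hx, s]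
    have hxk : x (f k) = ((r : ℤ) - p) * ((r : ℤ) - q) := by
      simp only [hx, hkv]; rw [if_neg (by omega)]
    rw [hupd, ← hxs, ← hxk, ← Matrix.det_updateCol_smul]
    have : (x s • fun i => buchiB n i s) = fun i => ∑ l, (- x (f l)) • A i l := by
      ext i; simpa using hker i
    rw [this, Matrix.det_updateCol_sum]
    simp

theorem buchi_base (n : ℕ) (hn : 3 ≤ n)
    (f : Fin (n - 2) → Fin (n + 1)) (hf : StrictMono f)
    (hrange : ∀ j : Fin (n + 1),
      j ∈ Set.range f ↔ ((j : ℕ) ≠ 1 ∧ (j : ℕ) ≠ 2 ∧ (j : ℕ) ≠ 3)) :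
    ((buchiB n).submatrix id f).det = -2 := by
  let g : Fin (n - 2) → Fin (n + 1) := fun i =>
    if (i : ℕ) = 0 then ⟨0, by omega⟩ else ⟨i + 3, by omega⟩
  have hg : StrictMono g := by
    intro i j hij
    have : (i : ℕ) < j := hij
    rw [Fin.lt_def]
    simp only [g]
    split_ifs <;> simp <;> omega
  have hfg : f = g := by
    apply (hf.range_inj hg).1
    ext j
    rw [hrange j]
    constructor
    · intro h
      by_cases h0 : (j : ℕ) = 0
      · exact ⟨⟨0, by omega⟩, by simp only [g]; exact Fin.ext h0.symm⟩
      · refine ⟨⟨j - 3, by omega⟩, ?_⟩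
        apply Fin.ext
        simp only [g]
        rw [if_neg (by omega)]; simp; omega
    · rintro ⟨i, rfl⟩
      simp only [g]
      split_ifs <;> simp <;> omega
  subst hfg
  rw [Matrix.det_of_isLowerTriangular]
  · obtain ⟨m, rfl⟩ : ∃ m, n = m + 3 := ⟨n - 3, by omega⟩
    change ∏ i : Fin (m + 1), _ = _
    rw [Fin.prod_univ_succ]
    rw [Finset.prod_eq_one]
    · simp [buchiB, g]
    · intro i _
      simp [buchiB, g]
  · intro i j hij
    have : (i : ℕ) < j := hij
    simp only [Matrix.submatrix_apply, id, buchiB, Matrix.of_apply, g]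
    rw [if_neg (by omega : ¬ (j : ℕ) = 0)]
    simp only
    rw [if_neg (by omega), if_neg (by omega), if_neg (by omega), if_neg (by omega)]

/-- Deleting the three columns `a < b < c` (with `1 ≤ a`, `c ≤ n`) from `B_n`
yields an `(n-2) × (n-2)` matrix of determinant
`(-1)^(a+b+c) * (a-b) * (a-c) * (b-c)`. -/
theorem buchiB_det_remove_three_cols (n a b c : ℕ) (hn : 3 ≤ n)
    (ha : 1 ≤ a) (hab : a < b) (hbc : b < c) (hcn : c ≤ n)
    (f : Fin (n - 2) → Fin (n + 1)) (hf : StrictMono f)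
    (hrange : ∀ j : Fin (n + 1),
      j ∈ Set.range f ↔ ((j : ℕ) ≠ a ∧ (j : ℕ) ≠ b ∧ (j : ℕ) ≠ c)) :
    ((buchiB n).submatrix id f).det =
      (-1) ^ (a + b + c) * ((a : ℤ) - b) * ((a : ℤ) - c) * ((b : ℤ) - c) := by
  induction hN : a + b + c using Nat.strong_induction_on generalizing a b c f with
  | _ N ih =>
  subst hN
  by_cases h1 : 1 < a
  · obtain ⟨r, rfl⟩ : ∃ r, a = r + 1 := ⟨a - 1, by omega⟩
    obtain ⟨f', hf', hr', hd⟩ := buchi_step n hn b c r (by omega) (by omega) (by omega) (by omega)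
      (by omega) (by omega) (by omega) (by omega) (by omega) (by omega) (by omega) f hf
      (fun j => by rw [hrange j]; tauto)
    have h := ih _ (by omega) r b c (by omega) (by omega) (by omega) hcn f' hf'
      (fun j => by rw [hr' j]; tauto) rfl
    have hx : ((r : ℤ) - b) * ((r : ℤ) - c) ≠ 0 := mul_ne_zero (by omega) (by omega)
    apply mul_left_cancel₀ hx
    rw [h] at hd
    push_cast
    rw [show r + 1 + b + c = (r + b + c) + 1 by ring, pow_succ]
    linear_combination hd
  by_cases h2 : a + 1 < b
  · obtain ⟨r, rfl⟩ : ∃ r, b = r + 1 := ⟨b - 1, by omega⟩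
    obtain ⟨f', hf', hr', hd⟩ := buchi_step n hn a c r (by omega) (by omega) (by omega) (by omega)
      (by omega) (by omega) (by omega) (by omega) (by omega) (by omega) (by omega) f hf
      (fun j => by rw [hrange j]; tauto)
    have h := ih _ (by omega) a r c (by omega) (by omega) (by omega) hcn f' hf'
      (fun j => by rw [hr' j]; tauto) rfl
    have hx : ((r : ℤ) - a) * ((r : ℤ) - c) ≠ 0 := mul_ne_zero (by omega) (by omega)
    apply mul_left_cancel₀ hx
    rw [h] at hd
    push_cast
    rw [show a + (r + 1) + c = (a + r + c) + 1 by ring, pow_succ]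
    linear_combination hd
  by_cases h3 : b + 1 < c
  · obtain ⟨r, rfl⟩ : ∃ r, c = r + 1 := ⟨c - 1, by omega⟩
    obtain ⟨f', hf', hr', hd⟩ := buchi_step n hn a b r (by omega) (by omega) (by omega) (by omega)
      (by omega) (by omega) (by omega) (by omega) (by omega) (by omega) (by omega) f hf
      (fun j => by rw [hrange j])
    have h := ih _ (by omega) a b r (by omega) (by omega) (by omega) (by omega) f' hf'
      (fun j => by rw [hr' j]) rfl
    have hx : ((r : ℤ) - a) * ((r : ℤ) - b) ≠ 0 := mul_ne_zero (by omega) (by omega)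
    apply mul_left_cancel₀ hx
    rw [h] at hd
    push_cast
    rw [show a + b + (r + 1) = (a + b + r) + 1 by ring, pow_succ]
    linear_combination hd
  obtain rfl : a = 1 := by omega
  obtain rfl : b = 2 := by omega
  obtain rfl : c = 3 := by omega
  rw [buchi_base n hn f hf hrange]
  norm_num
end

section
/- Let E be the elliptic curve over ℚ with equation y² = x³ − 8x² − 2x, and let p ≥ 5 be a prime (E has good reduction at every such p, since the discriminant of E is 2⁹·3²). If p is a supersingular prime for E, i.e., the number of affine points #{(x,y) ∈ 𝔽_p² : y² = x³ − 8x² − 2x} equals p (so that E(𝔽_p) has exactly p + 1 points), then p ≡ 5 (mod 24) or p ≡ 23 (mod 24). -/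
open Finset in
lemma ss_fiber {F : Type*} [Field F] [Fintype F] [DecidableEq F] (hF : ringChar F ≠ 2)
    (a b w : F) (hb : b ≠ 0) :
    ((univ.filter (fun x : F => x ≠ 0 ∧ x + b / x + a = w)).card : ℤ) =
      1 + quadraticChar F ((w - a) ^ 2 - 4 * b) := by
  have h2 : (2 : F) ≠ 0 := Ring.two_ne_zero hF
  rw [add_comm, ← quadraticChar_card_sqrts hF]
  norm_cast
  refine Finset.card_bij' (fun x _ => 2 * x - (w - a)) (fun y _ => (y + (w - a)) / 2) ?_ ?_ ?_ ?_
  · intro x hx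
    simp only [mem_filter, mem_univ, true_and] at hx
    obtain ⟨hx0, rfl⟩ := hx
    simp only [Set.mem_toFinset, Set.mem_ofPred_eq]
    field_simp
    ring
  · intro y hy
    simp only [Set.mem_toFinset, Set.mem_ofPred_eq] at hy
    simp only [mem_filter, mem_univ, true_and]
    have hne : (y + (w - a)) ≠ 0 := by
      intro h
      have : y = -(w - a) := by linear_combination h
      rw [this] at hy
      have h4 : 2 * (2 * b) = 0 := by linear_combination hy
      simp [h2, hb] at h4
    refine ⟨div_ne_zero hne h2, ?_⟩
    field_simp
    linear_combination hy
  · intro x _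
    field_simp
    ring
  · intro y _
    field_simp
    ring

open Finset in
lemma ss_iso {F : Type*} [Field F] [Fintype F] [DecidableEq F] (hF : ringChar F ≠ 2)
    (a b : F) (hb : b ≠ 0) :
    ∑ x : F, quadraticChar F (x * (x ^ 2 + a * x + b)) =
      ∑ w : F, quadraticChar F w * (1 + quadraticChar F ((w - a) ^ 2 - 4 * b)) := by
  have h1 : ∑ x : F, quadraticChar F (x * (x ^ 2 + a * x + b)) =
      ∑ x ∈ univ.filter (fun x : F => x ≠ 0), quadraticChar F (x + b / x + a) := by
    rw [sum_filter]
    refine sum_congr rfl fun x _ => ?_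
    split_ifs with h
    · have : x * (x ^ 2 + a * x + b) = x ^ 2 * (x + b / x + a) := by field_simp; ring
      rw [this, map_mul, quadraticChar_sq_one' h, one_mul]
    · push Not at h
      simp [h]
  rw [h1, ← sum_fiberwise_of_maps_to (t := univ) (g := fun x => x + b / x + a) (by simp)]
  refine sum_congr rfl fun w _ => ?_
  rw [← ss_fiber hF a b w hb, filter_filter]
  rw [sum_congr rfl (g := fun _ => quadraticChar F w)]
  · simp [mul_comm]
  · intro x hx
    simp only [mem_filter] at hx
    rw [hx.2.2]

open Finset in
lemma ss_total {F : Type*} [Field F] [Fintype F] [DecidableEq F] (hF : ringChar F ≠ 2)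
    (a b : F) (hb : b ≠ 0) :
    ∑ w : F, (1 + quadraticChar F ((w - a) ^ 2 - 4 * b)) = (Fintype.card F : ℤ) - 1 := by
  have h : (univ.filter (fun x : F => x ≠ 0)).card = Fintype.card F - 1 := by
    rw [filter_ne' univ (0:F), card_erase_of_mem (mem_univ _), card_univ]
  have h0 : 0 < Fintype.card F := Fintype.card_pos
  have h' : ((univ.filter (fun x : F => x ≠ 0)).card : ℤ) = (Fintype.card F : ℤ) - 1 := by
    omega
  rw [← h', card_eq_sum_card_fiberwise (t := univ) (f := fun x => x + b / x + a) (by simp)]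
  push_cast
  refine sum_congr rfl fun w _ => ?_
  rw [← ss_fiber hF a b w hb, filter_filter]

open Finset in
lemma ss_count {F : Type*} [Field F] [Fintype F] [DecidableEq F] (hF : ringChar F ≠ 2)
    (a b : F) (hb : b ≠ 0) :
    ∑ x : F, quadraticChar F (x * (x ^ 2 + a * x + b)) =
      ∑ w ∈ univ.filter (fun w : F => (w - a) ^ 2 - 4 * b = 0), quadraticChar F w +
      4 * ((univ.filter (fun w : F => quadraticChar F w = 1 ∧
        quadraticChar F ((w - a) ^ 2 - 4 * b) = 1)).card : ℤ) -
      2 * ((univ.filter (fun w : F => w ≠ 0 ∧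
        quadraticChar F ((w - a) ^ 2 - 4 * b) = 1)).card : ℤ) := by
  rw [ss_iso hF a b hb, sum_filter, card_filter, card_filter]
  push_cast
  rw [mul_sum, mul_sum, ← sum_add_distrib, ← sum_sub_distrib]
  refine sum_congr rfl fun w _ => ?_
  by_cases hq : (w - a) ^ 2 - 4 * b = 0
  · simp [hq]
  by_cases hw : w = 0
  · simp [hw]
  rcases quadraticChar_dichotomy hq with h | h <;> rcases quadraticChar_dichotomy hw with h' | h' <;>
    simp [h, h', hq, hw]

open Finset in
lemma ss_count2 {F : Type*} [Field F] [Fintype F] [DecidableEq F] (hF : ringChar F ≠ 2)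
    (a b : F) (hb : b ≠ 0) :
    ((univ.filter (fun w : F => (w - a) ^ 2 - 4 * b = 0)).card : ℤ) +
      2 * ((univ.filter (fun w : F => w ≠ 0 ∧
        quadraticChar F ((w - a) ^ 2 - 4 * b) = 1)).card : ℤ) +
      (if quadraticChar F (a ^ 2 - 4 * b) = 1 then 2 else 0) = (Fintype.card F : ℤ) - 1 := by
  rw [← ss_total hF a b hb, card_filter, card_filter]
  have h0 : (if quadraticChar F (a ^ 2 - 4 * b) = 1 then (2:ℤ) else 0) =
      ∑ w : F, if w = 0 then (if quadraticChar F (a ^ 2 - 4 * b) = 1 then 2 else 0) else 0 := by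
    rw [sum_ite_eq' univ (0:F)]; simp
  rw [h0]
  push_cast
  rw [mul_sum, ← sum_add_distrib, ← sum_add_distrib]
  refine sum_congr rfl fun w _ => ?_
  by_cases hw : w = 0
  · subst hw
    by_cases hq : a ^ 2 - 4 * b = 0
    · simp [hq]
    · rcases quadraticChar_dichotomy hq with h | h <;> simp [h, hq]
  by_cases hq : (w - a) ^ 2 - 4 * b = 0
  · simp [hq, hw]
  · rcases quadraticChar_dichotomy hq with h | h <;> simp [h, hq, hw]

open Finset in
lemma ss_even {F : Type*} [Field F] [Fintype F] [DecidableEq F]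
    (a b : F) (hd : quadraticChar F (a ^ 2 - 4 * b) = 1)
    (hfix : ∀ w : F, w ^ 2 = a ^ 2 - 4 * b → quadraticChar F w = 1 →
      quadraticChar F ((w - a) ^ 2 - 4 * b) ≠ 1) :
    Even (univ.filter (fun w : F => quadraticChar F w = 1 ∧
        quadraticChar F ((w - a) ^ 2 - 4 * b) = 1)).card := by
  set d := a ^ 2 - 4 * b with hdd
  have hd0 : d ≠ 0 := by
    intro h; rw [h] at hd; simp at hd
  rw [← ZMod.natCast_eq_zero_iff_even, ← nsmul_one, ← sum_const]
  have hw0 : ∀ w : F, quadraticChar F w = 1 → w ≠ 0 := by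
    intro w h h0; rw [h0] at h; simp at h
  refine sum_involution (fun w _ => d / w) ?_ ?_ ?_ ?_
  · intros; decide
  · intro w hw _ h
    simp only [mem_filter, mem_univ, true_and] at hw
    have := hw0 w hw.1
    refine hfix w ?_ hw.1 hw.2
    field_simp at h
    exact h.symm
  · intro w hw
    simp only [mem_filter, mem_univ, true_and] at hw ⊢
    have h0 := hw0 w hw.1
    have e1 : d / w = d * w * (w⁻¹) ^ 2 := by field_simp
    have e2 : (d / w - a) ^ 2 - 4 * b = d * ((w - a) ^ 2 - 4 * b) * (w⁻¹) ^ 2 := by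
      have : ((w - a) ^ 2 - 4 * b) = w ^ 2 - 2 * a * w + d := by rw [hdd]; ring
      rw [this]
      have : (d / w - a) ^ 2 - 4 * b = (d / w) ^ 2 - 2 * a * (d / w) + d := by rw [hdd]; ring
      rw [this]
      field_simp
      ring
    rw [e2, map_mul, map_mul, hd, hw.2, e1, map_mul, map_mul, hd, hw.1,
      quadraticChar_sq_one' (inv_ne_zero h0)]
    simp
  · intro w hw
    simp only [mem_filter, mem_univ, true_and] at hw
    have h0 := hw0 w hw.1
    field_simp

open Finset in
lemma ss_sum_zero (p : ℕ) [Fact p.Prime] (hp2 : p ≠ 2)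
    (hss : {q : ZMod p × ZMod p |
      q.2 ^ 2 = q.1 ^ 3 - 8 * q.1 ^ 2 - 2 * q.1}.ncard = p) :
    ∑ x : ZMod p, quadraticChar (ZMod p) (x * (x ^ 2 + (-8) * x + (-2))) = 0 := by
  have hF : ringChar (ZMod p) ≠ 2 := (ZMod.ringChar_zmod_n p).substr hp2
  have h1 : {q : ZMod p × ZMod p | q.2 ^ 2 = q.1 ^ 3 - 8 * q.1 ^ 2 - 2 * q.1}.ncard =
      ∑ x : ZMod p, ({y : ZMod p | y ^ 2 = x * (x ^ 2 + (-8) * x + (-2))}.toFinset).card := by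
    rw [Set.ncard_eq_toFinset_card', card_eq_sum_card_fiberwise (t := univ) (f := Prod.fst)
      (by simp)]
    refine sum_congr rfl fun x _ => ?_
    refine card_bij' (fun q _ => q.2) (fun y _ => (x, y)) ?_ ?_ ?_ ?_
    · rintro ⟨u, y⟩ h
      simp only [mem_filter, Set.mem_toFinset, Set.mem_ofPred_eq] at h ⊢
      obtain ⟨h, rfl⟩ := h
      rw [h]; ring
    · rintro y h
      simp only [mem_filter, Set.mem_toFinset, Set.mem_ofPred_eq] at h ⊢
      rw [h]; exact ⟨by ring, trivial⟩
    · rintro ⟨u, y⟩ h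
      simp only [mem_filter] at h
      simp [h.2]
    · intros; rfl
  rw [h1] at hss
  have h2 := congrArg (Nat.cast : ℕ → ℤ) hss
  push_cast at h2
  simp_rw [quadraticChar_card_sqrts hF] at h2
  rw [sum_add_distrib] at h2
  simpa [ZMod.card] using h2

open Finset in
lemma ss_zeros {F : Type*} [Field F] [Fintype F] [DecidableEq F] (a b c : F) (hbc : b = c ^ 2) :
    univ.filter (fun w : F => (w - a) ^ 2 - 4 * b = 0) = {a + 2 * c, a - 2 * c} := by
  ext w
  simp only [mem_filter, mem_univ, true_and, mem_insert, mem_singleton]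
  have : (w - a) ^ 2 - 4 * b = (w - (a + 2 * c)) * (w - (a - 2 * c)) := by rw [hbc]; ring
  rw [this, mul_eq_zero, sub_eq_zero, sub_eq_zero]

open Finset in
lemma ss_no_zeros {F : Type*} [Field F] [Fintype F] [DecidableEq F] (hF : ringChar F ≠ 2)
    (a b : F) (hb : ¬ IsSquare b) :
    univ.filter (fun w : F => (w - a) ^ 2 - 4 * b = 0) = ∅ := by
  have h2 : (2 : F) ≠ 0 := Ring.two_ne_zero hF
  refine filter_eq_empty_iff.mpr fun w _ h => hb ⟨(w - a) / 2, ?_⟩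
  field_simp
  linear_combination -h

open Finset Polynomial in
lemma ss_prod_poly (F : Type*) [Field F] [Fintype F] :
    ∏ x : F, (X - C x) = (X ^ Fintype.card F - X : F[X]) := by
  classical
  have hm : (X ^ Fintype.card F - X : F[X]).Monic :=
    monic_X_pow_sub (by rw [degree_X]; exact_mod_cast Fintype.one_lt_card)
  have := prod_multiset_X_sub_C_of_monic_of_roots_card_eq hm (by
    rw [FiniteField.roots_X_pow_card_sub_X,
      FiniteField.X_pow_card_sub_X_natDegree_eq F Fintype.one_lt_card]
    rfl)
  rw [FiniteField.roots_X_pow_card_sub_X] at this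
  exact this

open Finset Polynomial in
lemma ss_prod_sq {F : Type*} [Field F] [Fintype F] [DecidableEq F] (hF : ringChar F ≠ 2)
    (c : F) (hc : quadraticChar F c = -1) :
    ∏ x : F, (x ^ 2 - c) = - (4 * c) := by
  let K := AlgebraicClosure F
  obtain ⟨δ, hδ⟩ := IsAlgClosed.exists_pow_nat_eq (k := K) (algebraMap F K c) (n := 2) (by norm_num)
  have hodd : Fintype.card F % 2 = 1 := FiniteField.odd_card_of_char_ne_two hF
  have hp := congrArg (aeval δ) (ss_prod_poly F)
  simp only [map_prod, map_sub, aeval_X, aeval_C, map_pow] at hp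
  have hpow : δ ^ Fintype.card F = - δ := by
    have h1 := quadraticChar_eq_pow_of_char_ne_two' hF c
    rw [hc] at h1
    have h2 : δ ^ Fintype.card F = (δ ^ 2) ^ (Fintype.card F / 2) * δ := by
      rw [← pow_mul, ← pow_succ]; congr 1; omega
    rw [h2, hδ, ← map_pow, ← h1]; simp [neg_one_mul]; try ring
  rw [hpow] at hp
  have hp2 : ∏ x : F, (δ + algebraMap F K x) = -δ - δ := by
    rw [← hp]
    exact Fintype.prod_equiv (Equiv.neg F) _ _ (by intro x; simp)
  apply (algebraMap F K).injective
  rw [map_prod]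
  have : ∀ x : F, algebraMap F K (x ^ 2 - c) =
      (-1) * ((δ - algebraMap F K x) * (δ + algebraMap F K x)) := by
    intro x; rw [map_sub, map_pow, ← hδ]; ring
  simp_rw [this]
  rw [prod_mul_distrib, prod_mul_distrib, hp, hp2, prod_const, card_univ,
    Odd.neg_one_pow (Nat.odd_iff.mpr hodd)]
  simp only [map_neg, map_mul, map_ofNat, ← hδ]
  ring

open Finset in
lemma ss_prod_ne {F : Type*} [Field F] [Fintype F] [DecidableEq F] :
    ∏ x ∈ univ.filter (fun x : F => x ≠ 0), x = -1 := by
  have h := congrArg (Units.coeHom F) (FiniteField.prod_univ_units_id_eq_neg_one (K := F))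
  rw [map_prod] at h
  simp only [Units.coeHom_apply, Units.val_neg, Units.val_one] at h
  rw [← h, ← Finset.prod_coe_sort]
  symm
  exact Fintype.prod_equiv (unitsEquivNeZero.trans (Equiv.subtypeEquivRight (by simp))) _ _ (by intro x; rfl)

open Finset in
lemma ss_prod_V {F : Type*} [Field F] [Fintype F] [DecidableEq F] (hF : ringChar F ≠ 2)
    (a b : F) (hb : ¬ IsSquare b) (hd : quadraticChar F (a ^ 2 - 4 * b) = -1) :
    (∏ w ∈ univ.filter (fun w : F => w ≠ 0 ∧ quadraticChar F ((w - a) ^ 2 - 4 * b) = 1), w) ^ 2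
      * b = a ^ 2 - 4 * b := by
  have h2 : (2 : F) ≠ 0 := Ring.two_ne_zero hF
  have hb0 : b ≠ 0 := fun h => hb (h ▸ ⟨0, by simp⟩)
  have h1 : ∏ x ∈ univ.filter (fun x : F => x ≠ 0), (x + b / x + a) =
      (∏ w ∈ univ.filter (fun w : F => w ≠ 0 ∧
        quadraticChar F ((w - a) ^ 2 - 4 * b) = 1), w) ^ 2 := by
    rw [← prod_fiberwise_of_maps_to (t := univ) (g := fun x => x + b / x + a) (by simp),
      ← prod_pow, prod_filter]
    refine prod_congr rfl fun w _ => ?_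
    have hf := ss_fiber hF a b w hb0
    rw [filter_filter, prod_congr rfl (g := fun _ => w)
      (by intro x hx; simp only [mem_filter] at hx; exact hx.2.2), prod_const]
    have hq : (w - a) ^ 2 - 4 * b ≠ 0 := by
      intro h
      have := ss_no_zeros hF a b hb
      rw [filter_eq_empty_iff] at this
      exact this (mem_univ w) h
    rcases quadraticChar_dichotomy hq with h | h
    · have hw : w ≠ 0 := by
        rintro rfl
        rw [zero_sub, neg_sq, hd] at h
        norm_num at h
      rw [if_pos ⟨hw, h⟩]
      rw [h] at hf
      congr 1
      omega
    · rw [h] at hf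
      rw [if_neg (by rw [h]; norm_num)]
      have : #(univ.filter (fun x : F => x ≠ 0 ∧ x + b / x + a = w)) = 0 := by omega
      rw [this, pow_zero]
  have h3 : (∏ x ∈ univ.filter (fun x : F => x ≠ 0), (x + b / x + a)) * (-1) =
      ∏ x ∈ univ.filter (fun x : F => x ≠ 0), (x ^ 2 + a * x + b) := by
    rw [← ss_prod_ne, ← prod_mul_distrib]
    refine prod_congr rfl fun x hx => ?_
    simp only [mem_filter, mem_univ, true_and] at hx
    field_simp
    ring
  have h4 : ∏ x : F, (x ^ 2 + a * x + b) =
      b * ∏ x ∈ univ.filter (fun x : F => x ≠ 0), (x ^ 2 + a * x + b) := by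
    rw [filter_ne' univ (0:F), ← mul_prod_erase univ _ (mem_univ (0:F))]
    simp
  have h5 : ∏ x : F, (x ^ 2 + a * x + b) = - (a ^ 2 - 4 * b) := by
    have e : (a ^ 2 - 4 * b) = 4 * ((a ^ 2 - 4 * b) / 4) := by
      rw [mul_div_cancel₀]
      have : (4 : F) = 2 * 2 := by norm_num
      rw [this]; exact mul_ne_zero h2 h2
    have e2 : (a ^ 2 - 4 * b) / 4 = (a ^ 2 - 4 * b) * ((2 : F)⁻¹) ^ 2 := by
      rw [inv_pow, div_eq_mul_inv]; norm_num
    have hc : quadraticChar F ((a ^ 2 - 4 * b) / 4) = -1 := by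
      rw [e2, map_mul, hd, quadraticChar_sq_one' (inv_ne_zero h2), mul_one]
    have := ss_prod_sq hF _ hc
    rw [← e] at this
    rw [← this]
    refine Fintype.prod_equiv (Equiv.addRight (a / 2)) _ _ ?_
    intro x
    simp only [Equiv.coe_addRight, e2]
    field_simp
    ring
  rw [← h1]
  rw [h4, ← h3] at h5
  linear_combination -h5

open Finset in
lemma ss_char_prod {F : Type*} [Field F] [Fintype F] [DecidableEq F] (P : F → Prop)
    [DecidablePred P] :
    quadraticChar F (∏ w ∈ univ.filter (fun w : F => w ≠ 0 ∧ P w), w) =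
      (-1) ^ ((univ.filter (fun w : F => w ≠ 0 ∧ P w)).card +
        (univ.filter (fun w : F => quadraticChar F w = 1 ∧ P w)).card) := by
  rw [map_prod, card_filter, card_filter, ← sum_add_distrib, ← prod_pow_eq_pow_sum, prod_filter]
  refine prod_congr rfl fun w _ => ?_
  by_cases hP : P w
  · by_cases hw : w = 0
    · simp [hw]
    · rcases quadraticChar_dichotomy hw with h | h <;> simp [h, hw, hP]
  · simp [hP]

lemma ss_three (p : ℕ) [Fact p.Prime] (hp5 : 5 ≤ p) :
    (p % 24 = 13 → quadraticChar (ZMod p) 3 = 1) ∧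
    (p % 24 = 7 → quadraticChar (ZMod p) 3 = -1) := by
  have : Fact (Nat.Prime 3) := ⟨by norm_num⟩
  have h3 : (3 : ZMod p) ≠ 0 := by
    intro h
    have : ((3 : ℕ) : ZMod p) = 0 := by exact_mod_cast h
    rw [ZMod.natCast_eq_zero_iff] at this
    have := Nat.le_of_dvd (by norm_num) this
    omega
  have hmod : p % 3 = 1 → IsSquare ((p : ℕ) : ZMod 3) := by
    intro h
    have : ((p : ℕ) : ZMod 3) = ((1 : ℕ) : ZMod 3) := by
      rw [ZMod.natCast_eq_natCast_iff]; exact h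
    rw [this]; exact ⟨1, by simp⟩
  constructor
  · intro h
    rw [quadraticChar_one_iff_isSquare h3]
    have := (ZMod.exists_sq_eq_prime_iff_of_mod_four_eq_one (p := p) (q := 3)
      (by omega) (by norm_num)).mpr (hmod (by omega))
    exact_mod_cast this
  · intro h
    rw [quadraticChar_neg_one_iff_not_isSquare]
    have := (ZMod.exists_sq_eq_prime_iff_of_mod_four_eq_three (p := p) (q := 3)
      (by omega) (by norm_num) (by omega)).not.mpr (not_not.mpr (hmod (by omega)))
    exact_mod_cast this

/-- Every supersingular prime `p ≥ 5` of the elliptic curve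
`E : y² = x³ − 8x² − 2x` (i.e. a prime of good reduction with
`#E(𝔽_p) = p + 1`, equivalently with exactly `p` affine points) is congruent
to `5` or `23` modulo `24`. -/
theorem supersingular_primes_mod_24 (p : ℕ) (hp : p.Prime) (hp5 : 5 ≤ p)
    (hss : {q : ZMod p × ZMod p |
      q.2 ^ 2 = q.1 ^ 3 - 8 * q.1 ^ 2 - 2 * q.1}.ncard = p) :
    p % 24 = 5 ∨ p % 24 = 23 := by
  have : Fact p.Prime := ⟨hp⟩
  have hp2 : p ≠ 2 := by omega
  have hF : ringChar (ZMod p) ≠ 2 := (ZMod.ringChar_zmod_n p).substr hp2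
  have hS := ss_sum_zero p hp2 hss
  have h2 : (2 : ZMod p) ≠ 0 := Ring.two_ne_zero hF
  have h3 : (3 : ZMod p) ≠ 0 := by
    intro h
    have : ((3 : ℕ) : ZMod p) = 0 := by exact_mod_cast h
    rw [ZMod.natCast_eq_zero_iff] at this
    have := Nat.le_of_dvd (by norm_num) this
    omega
  have hm2 : (-2 : ZMod p) ≠ 0 := neg_ne_zero.mpr h2
  obtain ⟨hc13, hc7⟩ := ss_three p hp5
  have sq2 := ZMod.exists_sq_eq_two_iff (p := p) hp2
  have sqm2 := ZMod.exists_sq_eq_neg_two_iff (p := p) hp2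
  have hodd : p % 2 = 1 := hp.eq_two_or_odd.resolve_left hp2
  have hmod3 : p % 3 ≠ 0 := by
    intro h
    have := (Nat.prime_dvd_prime_iff_eq Nat.prime_three hp).mp (Nat.dvd_of_mod_eq_zero h)
    omega
  have hd : ((-8 : ZMod p) ^ 2 - 4 * (-2)) = 2 * 6 ^ 2 := by norm_num
  have h6 : (6 : ZMod p) ≠ 0 := by
    have : (6 : ZMod p) = 2 * 3 := by norm_num
    rw [this]; exact mul_ne_zero h2 h3
  have hd2 : quadraticChar (ZMod p) ((-8 : ZMod p) ^ 2 - 4 * (-2)) = quadraticChar (ZMod p) 2 := by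
    rw [hd, map_mul, quadraticChar_sq_one' h6, mul_one]
  have hc1 := ss_count hF (-8 : ZMod p) (-2) hm2
  have hc2 := ss_count2 hF (-8 : ZMod p) (-2) hm2
  rw [hS] at hc1
  rw [hd2, ZMod.card] at hc2
  have h8 : p % 8 = 1 ∨ p % 8 = 3 ∨ p % 8 = 5 ∨ p % 8 = 7 := by omega
  rcases h8 with h8 | h8 | h8 | h8
  · exfalso
    obtain ⟨s, hs⟩ := sqm2.mpr (by omega)
    have hs0 : s ≠ 0 := by rintro rfl; exact hm2 (by rw [hs]; ring)
    have hχ2 := (quadraticChar_one_iff_isSquare h2).mpr (sq2.mpr (by omega))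
    rw [hχ2, if_pos rfl] at hc2
    rw [ss_zeros (-8 : ZMod p) (-2) s (by rw [hs]; ring)] at hc1 hc2
    have hne : (-8 + 2 * s : ZMod p) ≠ -8 - 2 * s := by
      intro h
      have : 2 * (2 * s) = 0 := by linear_combination h
      simp [h2, hs0] at this
    rw [Finset.sum_pair hne] at hc1
    rw [Finset.card_pair hne] at hc2
    have hprod : quadraticChar (ZMod p) (-8 + 2 * s) * quadraticChar (ZMod p) (-8 - 2 * s) = 1 := by
      rw [← map_mul, ← hχ2, ← hd2]
      congr 1
      linear_combination 4 * hs
    have hpm : (quadraticChar (ZMod p) (-8 + 2 * s) = 1 ∧ quadraticChar (ZMod p) (-8 - 2 * s) = 1) ∨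
        (quadraticChar (ZMod p) (-8 + 2 * s) = -1 ∧ quadraticChar (ZMod p) (-8 - 2 * s) = -1) :=
      Int.mul_eq_one_iff_eq_one_or_neg_one.mp hprod
    push_cast at hc2
    rcases hpm with ⟨e1, e2⟩ | ⟨e1, e2⟩ <;> rw [e1, e2] at hc1 <;> omega
  · exfalso
    obtain ⟨s₀, hs₀⟩ := sqm2.mpr (by omega)
    have hneg : ¬ IsSquare (-1 : ZMod p) := by
      rw [ZMod.exists_sq_eq_neg_one_iff]; omega
    have hm1 : quadraticChar (ZMod p) (-1) = -1 := quadraticChar_neg_one_iff_not_isSquare.mpr hneg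
    have hs00 : s₀ ≠ 0 := by rintro rfl; exact hm2 (by rw [hs₀]; ring)
    obtain ⟨t, ht⟩ : ∃ t : ZMod p, t ^ 4 = -2 := by
      rcases quadraticChar_dichotomy hs00 with h | h
      · obtain ⟨t, ht⟩ := (quadraticChar_one_iff_isSquare hs00).mp h
        exact ⟨t, by rw [hs₀, ht]; ring⟩
      · have : quadraticChar (ZMod p) (-s₀) = 1 := by
          rw [neg_eq_neg_one_mul, map_mul, hm1, h]; norm_num
        obtain ⟨t, ht⟩ := (quadraticChar_one_iff_isSquare (neg_ne_zero.mpr hs00)).mp this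
        exact ⟨t, by linear_combination (-(t ^ 2) + s₀) * ht - hs₀⟩
    have ht0 : t ≠ 0 := by rintro rfl; exact hm2 (by rw [← ht]; ring)
    obtain ⟨A, hA⟩ : ∃ A, A = 2 * t := ⟨_, rfl⟩
    obtain ⟨B, hB⟩ : ∃ B, B = t ^ 3 * (1 - t ^ 2) := ⟨_, rfl⟩
    have hA2 : A ^ 2 = 4 * t ^ 2 := by rw [hA]; ring
    have hB2 : B ^ 2 = 2 * t ^ 2 - 8 := by
      rw [hB]; linear_combination (t ^ 6 - 2 * t ^ 4 - t ^ 2 + 4) * ht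
    have h72 : (2 * t ^ 2 - 8) * (2 * t ^ 2 + 8) = -(2 * 6 ^ 2) := by
      linear_combination 4 * ht
    have h72' : (-(2 * 6 ^ 2) : ZMod p) ≠ 0 :=
      neg_ne_zero.mpr (mul_ne_zero h2 (pow_ne_zero _ h6))
    rw [← h72] at h72'
    have hA0 : A ≠ 0 := by rw [hA]; exact mul_ne_zero h2 ht0
    have hB0 : B ≠ 0 := by
      intro h; apply left_ne_zero_of_mul h72'; rw [← hB2, h]; ring
    have hD0 : A ^ 2 - B ^ 2 ≠ 0 := by
      intro h; apply right_ne_zero_of_mul h72'; linear_combination h - hA2 + hB2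
    have hS' : ∑ x : ZMod p, quadraticChar (ZMod p)
        (x * (x ^ 2 + (A ^ 2 + B ^ 2) * x + (A * B) ^ 2)) = 0 := by
      rw [ss_iso hF _ _ hm2] at hS
      simp_rw [mul_add, mul_one, Finset.sum_add_distrib, quadraticChar_sum_zero hF, zero_add,
        ← map_mul] at hS
      rw [← hS]
      refine Fintype.sum_equiv (Equiv.addRight (2 * t ^ 2 - 8)) _ _ ?_
      intro x
      simp only [Equiv.coe_addRight]
      congr 1
      rw [mul_pow, hA2, hB2]
      linear_combination (-4 * (x + 2 * t ^ 2 - 8)) * ht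
    have hAB : (A * B) ^ 2 ≠ 0 := pow_ne_zero _ (mul_ne_zero hA0 hB0)
    have hc1 := ss_count hF (A ^ 2 + B ^ 2) _ hAB
    have hc2 := ss_count2 hF (A ^ 2 + B ^ 2) _ hAB
    have hdd : (A ^ 2 + B ^ 2) ^ 2 - 4 * (A * B) ^ 2 = (A ^ 2 - B ^ 2) ^ 2 := by ring
    have hdc : quadraticChar (ZMod p) ((A ^ 2 + B ^ 2) ^ 2 - 4 * (A * B) ^ 2) = 1 := by
      rw [hdd, quadraticChar_sq_one' hD0]
    have hev := ss_even (A ^ 2 + B ^ 2) ((A * B) ^ 2) hdc (by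
      intro w hw hw1 hq
      rw [hdd, sq_eq_sq_iff_eq_or_eq_neg] at hw
      rcases hw with hw | hw
      · have : (w - (A ^ 2 + B ^ 2)) ^ 2 - 4 * (A * B) ^ 2 = -1 * w * (2 * B) ^ 2 := by
          rw [hw]; ring
        rw [this, map_mul, map_mul, hw1, hm1, quadraticChar_sq_one' (mul_ne_zero h2 hB0)] at hq
        norm_num at hq
      · have : (w - (A ^ 2 + B ^ 2)) ^ 2 - 4 * (A * B) ^ 2 = -1 * w * (2 * A) ^ 2 := by
          rw [hw]; ring
        rw [this, map_mul, map_mul, hw1, hm1, quadraticChar_sq_one' (mul_ne_zero h2 hA0)] at hq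
        norm_num at hq)
    rw [hS'] at hc1
    rw [hdc, if_pos rfl, ZMod.card] at hc2
    rw [ss_zeros _ _ (A * B) rfl] at hc1 hc2
    have hne : (A ^ 2 + B ^ 2 + 2 * (A * B)) ≠ A ^ 2 + B ^ 2 - 2 * (A * B) := by
      intro h
      have : 2 * (2 * (A * B)) = 0 := by linear_combination h
      simp [h2, hA0, hB0] at this
    rw [Finset.sum_pair hne] at hc1
    rw [Finset.card_pair hne] at hc2
    have hfac : (A + B) * (A - B) ≠ 0 := by
      intro h; apply hD0; linear_combination h
    have e1 : quadraticChar (ZMod p) (A ^ 2 + B ^ 2 + 2 * (A * B)) = 1 := by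
      rw [← quadraticChar_sq_one' (left_ne_zero_of_mul hfac)]; congr 1; ring
    have e2 : quadraticChar (ZMod p) (A ^ 2 + B ^ 2 - 2 * (A * B)) = 1 := by
      rw [← quadraticChar_sq_one' (right_ne_zero_of_mul hfac)]; congr 1; ring
    rw [e1, e2] at hc1
    push_cast at hc2
    obtain ⟨k, hk⟩ := hev
    rw [hk] at hc1
    push_cast at hc1
    omega
  · left
    by_contra hne5
    have h24 : p % 24 = 13 := by omega
    have hχ3 := hc13 h24
    have hns : ¬ IsSquare (-2 : ZMod p) := by rw [sqm2]; omega
    have hχ2 : quadraticChar (ZMod p) 2 = -1 :=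
      quadraticChar_neg_one_iff_not_isSquare.mpr (by rw [sq2]; omega)
    rw [ss_no_zeros hF _ _ hns] at hc1 hc2
    rw [hχ2] at hc2
    have hW := ss_prod_V hF (-8 : ZMod p) (-2) hns (by rw [hd2, hχ2])
    have hχW := ss_char_prod (F := ZMod p)
      (fun w => quadraticChar (ZMod p) ((w - (-8)) ^ 2 - 4 * (-2)) = 1)
    set W := ∏ w ∈ Finset.univ.filter (fun w : ZMod p => w ≠ 0 ∧
      quadraticChar (ZMod p) ((w - (-8)) ^ 2 - 4 * (-2)) = 1), w with hWdef
    rw [if_neg (by norm_num)] at hc2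
    simp only [Finset.sum_empty, Finset.card_empty] at hc1 hc2
    push_cast at hc2
    rw [Odd.neg_one_pow (by rw [Nat.odd_iff]; omega)] at hχW
    have hW2 : W ^ 2 = -(6 ^ 2) := by
      have : (2 : ZMod p) * (W ^ 2 + 6 ^ 2) = 0 := by linear_combination -hW
      have := (mul_eq_zero.mp this).resolve_left h2
      linear_combination this
    have hkey : (W + 6) ^ 2 = 2 * (2 * 3) * W := by linear_combination hW2
    have hW0 : W ≠ 0 := by
      intro h; rw [h] at hχW; simp at hχW
    have h0 : W + 6 ≠ 0 := by
      intro h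
      rw [h] at hkey
      have : 2 * (2 * 3) * W ≠ 0 := mul_ne_zero (mul_ne_zero h2 (mul_ne_zero h2 h3)) hW0
      exact this (by rw [← hkey]; ring)
    have := quadraticChar_sq_one' h0
    rw [hkey, map_mul, map_mul, map_mul, hχ2, hχ3, hχW] at this
    norm_num at this
  · right
    by_contra hne23
    have h24 : p % 24 = 7 := by omega
    have hχ3 := hc7 h24
    have hns : ¬ IsSquare (-2 : ZMod p) := by rw [sqm2]; omega
    have hsq2 := sq2.mpr (by omega)
    have hχ2 := (quadraticChar_one_iff_isSquare h2).mpr hsq2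
    obtain ⟨r, hr⟩ := hsq2
    rw [ss_no_zeros hF _ _ hns] at hc1 hc2
    rw [hχ2, if_pos rfl] at hc2
    have hfix : ∀ r w : ZMod p, 2 = r * r → w = 6 * r →
        quadraticChar (ZMod p) ((w - (-8)) ^ 2 - 4 * (-2)) ≠ 1 := by
      intro r w hr hw hq
      have e : (w - (-8)) ^ 2 - 4 * (-2) = 3 * (4 * (1 + r)) ^ 2 := by
        rw [hw]; linear_combination (12 : ZMod p) * hr
      rw [e] at hq
      have h0 : (4 * (1 + r)) ≠ 0 := by
        intro h; rw [h] at hq; simp at hq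
      rw [map_mul, hχ3, quadraticChar_sq_one' h0] at hq
      norm_num at hq
    have hev := ss_even (-8 : ZMod p) (-2) (by rw [hd2, hχ2]) (by
      intro w hw _
      have : w ^ 2 = (6 * r) ^ 2 := by rw [hw, hd]; linear_combination 36 * hr
      rcases sq_eq_sq_iff_eq_or_eq_neg.mp this with h | h
      · exact hfix r w hr h
      · exact hfix (-r) w (by rw [hr]; ring) (by rw [h]; ring))
    obtain ⟨k, hk⟩ := hev
    rw [hk] at hc1
    simp only [Finset.sum_empty, Finset.card_empty] at hc1 hc2
    push_cast at hc1 hc2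
    omega
end

section
/- Let p be a prime with p ≡ 23 (mod 24) which is supersingular for the elliptic curve E: y² = x³ − 8x² − 2x, i.e., #{(x,y) ∈ 𝔽_p² : y² = x³ − 8x² − 2x} = p. Then the number of 𝔽_p-points of the Büchi K3 surface X₅ equals p² + 18p + 1; concretely, the number of nonzero vectors (x_0,…,x_5) ∈ 𝔽_p⁶ satisfying the three equations x_3² − 2x_2² + x_1² = 2x_0², x_4² − 2x_3² + x_2² = 2x_0², x_5² − 2x_4² + x_3² = 2x_0² equals (p − 1)·(p² + 18p + 1). -/
section Buchi

set_option linter.unusedSectionVars false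

variable {F : Type*} [Field F] [Fintype F] [DecidableEq F]

/-- The value at `(A : B)` of the binary quadratic form with coefficients `v`. -/
def bLn (A B : F) (v : F × F × F) : F := A ^ 2 * v.1 + A * B * v.2.1 + B ^ 2 * v.2.2

theorem b_quadsum (hF : ringChar F ≠ 2) (α δ : F) :
    ∑ x : F, quadraticChar F (x * (α * x + δ)) =
      quadraticChar F α * ((if δ = 0 then (Fintype.card F : ℤ) else 0) - 1) := by
  have h1 : ∀ x : F, quadraticChar F (x * (α * x + δ)) =
      quadraticChar F (α + δ * x⁻¹) - if x = 0 then quadraticChar F α else 0 := by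
    intro x
    by_cases hx : x = 0
    · subst hx; simp
    · have : x * (α * x + δ) = x ^ 2 * (α + δ * x⁻¹) := by field_simp
      rw [this, map_mul, quadraticChar_sq_one' hx]
      simp [hx]
  rw [Finset.sum_congr rfl (fun x _ => h1 x), Finset.sum_sub_distrib]
  have h2 : ∑ x : F, quadraticChar F (α + δ * x⁻¹) =
      quadraticChar F α * (if δ = 0 then (Fintype.card F : ℤ) else 0) := by
    by_cases hd : δ = 0
    · subst hd; simp [mul_comm]
    · rw [if_neg hd, mul_zero, ← quadraticChar_sum_zero hF]
      exact Equiv.sum_comp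
        ((((inv_involutive (G := F)).toPerm _).trans (Equiv.mulLeft₀ δ hd)).trans (Equiv.addLeft α)) (quadraticChar F)
  rw [h2, Finset.sum_ite_eq', if_pos (Finset.mem_univ _)]; ring

theorem b_sum3 (hF : ringChar F ≠ 2) (α β γ : F) (hβ : β ≠ 0) (hγ : γ ≠ 0) :
    ∑ y : F, ∑ z : F, ∑ x : F, quadraticChar F (x * y * z * (α * x + β * y + γ * z)) =
      quadraticChar F (-(α * β * γ)) * ((Fintype.card F : ℤ) * (Fintype.card F - 1)) := by
  have h1 : ∀ y z : F, ∑ x : F, quadraticChar F (x * y * z * (α * x + β * y + γ * z)) =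
      (if z = -(β * y) / γ then
        (quadraticChar F y * quadraticChar F z) * (quadraticChar F α * Fintype.card F) else 0)
       - quadraticChar F y * quadraticChar F z * quadraticChar F α := by
    intro y z
    have : ∀ x : F, quadraticChar F (x * y * z * (α * x + β * y + γ * z)) =
        (quadraticChar F y * quadraticChar F z) *
          quadraticChar F (x * (α * x + (β * y + γ * z))) := by
      intro x
      rw [← map_mul, ← map_mul]; congr 1; ring
    rw [Finset.sum_congr rfl (fun x _ => this x), ← Finset.mul_sum, b_quadsum hF]
    have hiff : β * y + γ * z = 0 ↔ z = -(β * y) / γ := by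
      rw [eq_div_iff hγ]; constructor <;> intro h <;> linear_combination h
    simp only [hiff]
    split_ifs <;> ring
  have h0 : ∑ y : F, ∑ z : F, quadraticChar F y * quadraticChar F z * quadraticChar F α = 0 := by
    simp only [← Finset.sum_mul, ← Finset.mul_sum, quadraticChar_sum_zero hF]
    simp
  simp only [h1, Finset.sum_sub_distrib, h0, Finset.sum_ite_eq', Finset.mem_univ, if_true, sub_zero]
  have h2 : ∀ y : F, quadraticChar F y * quadraticChar F (-(β * y) / γ) *
      (quadraticChar F α * Fintype.card F) =
      quadraticChar F (-(α * β * γ)) * Fintype.card F * (if y = 0 then 0 else 1) := by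
    intro y
    by_cases hy : y = 0
    · simp [hy]
    · have e : y * (-(β * y) / γ) * α = (y / γ) ^ 2 * (-(α * β * γ)) := by field_simp
      rw [← map_mul, ← mul_assoc, ← map_mul, e, map_mul, quadraticChar_sq_one' (div_ne_zero hy hγ)]
      simp [hy]
  rw [Finset.sum_congr rfl (fun y _ => h2 y), ← Finset.mul_sum]
  have h3 : ∑ y : F, (if y = 0 then (0 : ℤ) else 1) = Fintype.card F - 1 := by
    have : ∀ y : F, (if y = 0 then (0 : ℤ) else 1) = 1 - if y = 0 then 1 else 0 := by
      intro y; split_ifs <;> simp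
    simp [this]
  rw [h3]; ring

theorem b_change3 (A₁ B₁ A₂ B₂ A₃ B₃ : F) (h12 : A₁ * B₂ - A₂ * B₁ ≠ 0)
    (h13 : A₁ * B₃ - A₃ * B₁ ≠ 0) (h23 : A₂ * B₃ - A₃ * B₂ ≠ 0) (G : F → F → F → ℤ) :
    ∑ v, G (bLn A₁ B₁ v) (bLn A₂ B₂ v) (bLn A₃ B₃ v) = ∑ y, ∑ z, ∑ x, G x y z := by
  have hinj : Function.Injective
      (fun v : F × F × F => (bLn A₂ B₂ v, bLn A₃ B₃ v, bLn A₁ B₁ v)) := by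
    rintro ⟨a, b, c⟩ ⟨a', b', c'⟩ h
    simp only [bLn, Prod.mk.injEq] at h
    obtain ⟨e2, e3, e1⟩ := h
    have hd : (A₁ * B₂ - A₂ * B₁) * (A₁ * B₃ - A₃ * B₁) * (A₂ * B₃ - A₃ * B₂) ≠ 0 :=
      mul_ne_zero (mul_ne_zero h12 h13) h23
    simp only [Prod.mk.injEq]
    refine ⟨mul_left_cancel₀ hd ?_, mul_left_cancel₀ hd ?_, mul_left_cancel₀ hd ?_⟩
    · linear_combination (B₂ * B₃ * (A₂ * B₃ - A₃ * B₂)) * e1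
        - (B₁ * B₃ * (A₁ * B₃ - A₃ * B₁)) * e2 + (B₁ * B₂ * (A₁ * B₂ - A₂ * B₁)) * e3
    · linear_combination -(A₂ ^ 2 * B₃ ^ 2 - A₃ ^ 2 * B₂ ^ 2) * e1
        + (A₁ ^ 2 * B₃ ^ 2 - A₃ ^ 2 * B₁ ^ 2) * e2 - (A₁ ^ 2 * B₂ ^ 2 - A₂ ^ 2 * B₁ ^ 2) * e3
    · linear_combination (A₂ * A₃ * (A₂ * B₃ - A₃ * B₂)) * e1
        - (A₁ * A₃ * (A₁ * B₃ - A₃ * B₁)) * e2 + (A₁ * A₂ * (A₁ * B₂ - A₂ * B₁)) * e3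
  have hbij := (Finite.injective_iff_bijective).1 hinj
  rw [hbij.sum_comp (fun w : F × F × F => G w.2.2 w.1 w.2.1) ]
  simp only [Fintype.sum_prod_type]

theorem b_sum4 (hF : ringChar F ≠ 2) (A₁ B₁ A₂ B₂ A₃ B₃ A₄ B₄ : F)
    (h12 : A₁ * B₂ - A₂ * B₁ ≠ 0) (h13 : A₁ * B₃ - A₃ * B₁ ≠ 0)
    (h23 : A₂ * B₃ - A₃ * B₂ ≠ 0) (h14 : A₁ * B₄ - A₄ * B₁ ≠ 0)
    (h24 : A₂ * B₄ - A₄ * B₂ ≠ 0) (h34 : A₃ * B₄ - A₄ * B₃ ≠ 0) :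
    ∑ v, quadraticChar F (bLn A₁ B₁ v * bLn A₂ B₂ v * bLn A₃ B₃ v * bLn A₄ B₄ v) =
      (Fintype.card F : ℤ) * (Fintype.card F - 1) := by
  obtain ⟨d12, e12⟩ : ∃ d, d = A₁ * B₂ - A₂ * B₁ := ⟨_, rfl⟩
  obtain ⟨d13, e13⟩ : ∃ d, d = A₁ * B₃ - A₃ * B₁ := ⟨_, rfl⟩
  obtain ⟨d23, e23⟩ : ∃ d, d = A₂ * B₃ - A₃ * B₂ := ⟨_, rfl⟩
  obtain ⟨d14, e14⟩ : ∃ d, d = A₁ * B₄ - A₄ * B₁ := ⟨_, rfl⟩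
  obtain ⟨d24, e24⟩ : ∃ d, d = A₂ * B₄ - A₄ * B₂ := ⟨_, rfl⟩
  obtain ⟨d34, e34⟩ : ∃ d, d = A₃ * B₄ - A₄ * B₃ := ⟨_, rfl⟩
  have key : ∀ v, bLn A₄ B₄ v = d24 * d34 / (d12 * d13) * bLn A₁ B₁ v
      + (-(d14 * d34 / (d12 * d23))) * bLn A₂ B₂ v + d14 * d24 / (d13 * d23) * bLn A₃ B₃ v := by
    rintro ⟨a, b, c⟩
    rw [← e12] at h12; rw [← e13] at h13; rw [← e23] at h23
    field_simp
    simp only [bLn, e12, e13, e23, e14, e24, e34]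
    ring
  simp only [key]
  rw [b_change3 A₁ B₁ A₂ B₂ A₃ B₃ h12 h13 h23 (fun x y z => quadraticChar F (x * y * z *
    (d24 * d34 / (d12 * d13) * x + (-(d14 * d34 / (d12 * d23))) * y + d14 * d24 / (d13 * d23) * z)))]
  rw [← e12] at h12; rw [← e13] at h13; rw [← e23] at h23
  rw [← e14] at h14; rw [← e24] at h24; rw [← e34] at h34
  clear e12 e13 e23 e14 e24 e34 key
  rw [b_sum3 hF _ _ _ (by simp [*]) (by simp [*])]
  have : -(d24 * d34 / (d12 * d13) * -(d14 * d34 / (d12 * d23)) * (d14 * d24 / (d13 * d23)))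
     = (d24 * d34 * d14 / (d12 * d13 * d23)) ^ 2 := by field_simp
  rw [this, quadraticChar_sq_one' (by simp [*]), one_mul]

/-- Scaling. -/
theorem b_scale (G : F → F → F → ℤ) (h0 : ∀ b c, G 0 b c = 0)
    (h1 : ∀ a b c, a ≠ 0 → G a (a * b) (a * c) = G 1 b c) :
    ∑ v : F × F × F, G v.1 v.2.1 v.2.2 = (Fintype.card F - 1) * ∑ b, ∑ c, G 1 b c := by
  simp only [Fintype.sum_prod_type]
  have : ∀ a : F, ∑ b, ∑ c, G a b c = (1 - if a = 0 then 1 else 0) * ∑ b, ∑ c, G 1 b c := by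
    intro a
    by_cases ha : a = 0
    · simp [ha, h0]
    · rw [← Equiv.sum_comp (Equiv.mulLeft₀ a ha)]
      simp only [ha, if_false, sub_zero, one_mul]
      refine Finset.sum_congr rfl fun b _ => ?_
      rw [← Equiv.sum_comp (Equiv.mulLeft₀ a ha)]
      exact Finset.sum_congr rfl fun c _ => h1 a b c ha
  rw [Finset.sum_congr rfl (fun a _ => this a), ← Finset.sum_mul]
  simp

/-- Number of roots of a monic quadratic. -/
theorem b_roots (hF : ringChar F ≠ 2) (u c : F) :
    ((Finset.univ.filter fun z : F => z ^ 2 - u * z + c = 0).card : ℤ) =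
      quadraticChar F (u ^ 2 - 4 * c) + 1 := by
  have h2 : (2 : F) ≠ 0 := Ring.two_ne_zero hF
  rw [← quadraticChar_card_sqrts hF]
  norm_cast
  refine Finset.card_bij (fun z _ => 2 * z - u) ?_ ?_ ?_
  · intro z hz
    simp only [Finset.mem_filter, Finset.mem_univ, true_and] at hz
    simp only [Set.mem_toFinset, Set.mem_ofPred_eq]
    linear_combination 4 * hz
  · intro z _ z' _ h
    exact mul_left_cancel₀ h2 (by linear_combination h)
  · intro y hy
    simp only [Set.mem_toFinset, Set.mem_ofPred_eq] at hy
    refine ⟨(y + u) / 2, ?_, by field_simp; ring⟩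
    simp only [Finset.mem_filter, Finset.mem_univ, true_and]
    have h4 : (4 : F) ≠ 0 := by
      have : (4 : F) = 2 * 2 := by norm_num
      rw [this]; exact mul_ne_zero h2 h2
    field_simp
    linear_combination hy

theorem b_symm (hF : ringChar F ≠ 2) (hm : quadraticChar F (-1) = -1) (G : F → F → ℤ) :
    2 * ∑ b, ∑ c, G b c = ∑ r, ∑ s, G (-(r + s)) (r * s) + ∑ x, ∑ y, G (-(2 * x)) (x ^ 2 + y ^ 2) := by
  have h2 : (2 : F) ≠ 0 := Ring.two_ne_zero hF
  have h4 : (4 : F) ≠ 0 := by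
    have : (4 : F) = 2 * 2 := by norm_num
    rw [this]; exact mul_ne_zero h2 h2
  have hS : ∑ r, ∑ s, G (-(r + s)) (r * s) =
      ∑ b, ∑ c, G b c * (quadraticChar F (b ^ 2 - 4 * c) + 1) := by
    have e1 : ∀ r : F, ∑ s, G (-(r + s)) (r * s) = ∑ b, G b (r * (-b - r)) := by
      intro r
      rw [← Equiv.sum_comp ((Equiv.addLeft r).trans (Equiv.neg F))]
      refine Finset.sum_congr rfl fun s _ => ?_
      simp [sub_eq_add_neg]
    simp only [e1]
    rw [Finset.sum_comm]
    refine Finset.sum_congr rfl fun b _ => ?_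
    have e2 : ∀ r : F, G b (r * (-b - r)) = ∑ c, if r ^ 2 - (-b) * r + c = 0 then G b c else 0 := by
      intro r
      have : ∀ c, (r ^ 2 - (-b) * r + c = 0) ↔ c = r * (-b - r) := by
        intro c; constructor <;> intro h <;> linear_combination h
      simp only [this, Finset.sum_ite_eq', Finset.mem_univ, if_true]
    simp only [e2]
    rw [Finset.sum_comm]
    refine Finset.sum_congr rfl fun c _ => ?_
    have := b_roots hF (-b) c
    rw [neg_sq] at this
    rw [← this, ← Finset.sum_filter, Finset.sum_const, nsmul_eq_mul, mul_comm]
  have hK : ∑ x, ∑ y, G (-(2 * x)) (x ^ 2 + y ^ 2) =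
      ∑ b, ∑ c, G b c * (1 - quadraticChar F (b ^ 2 - 4 * c)) := by
    rw [← Equiv.sum_comp ((Equiv.mulLeft₀ 2 h2).trans (Equiv.neg F))
      (fun b => ∑ c, G b c * (1 - quadraticChar F (b ^ 2 - 4 * c)))]
    refine Finset.sum_congr rfl fun x _ => ?_
    simp only [Equiv.trans_apply, Equiv.neg_apply, Equiv.mulLeft₀_apply]
    have e2 : ∀ y : F, G (-(2 * x)) (x ^ 2 + y ^ 2) =
        ∑ c, if y ^ 2 - 0 * y + (x ^ 2 - c) = 0 then G (-(2 * x)) c else 0 := by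
      intro y
      have : ∀ c, (y ^ 2 - 0 * y + (x ^ 2 - c) = 0) ↔ c = x ^ 2 + y ^ 2 := by
        intro c; constructor <;> intro h <;> linear_combination -h
      simp only [this, Finset.sum_ite_eq', Finset.mem_univ, if_true]
    simp only [e2]
    rw [Finset.sum_comm]
    refine Finset.sum_congr rfl fun c _ => ?_
    rw [← Finset.sum_filter, Finset.sum_const, nsmul_eq_mul, mul_comm, b_roots hF]
    have : (0 : F) ^ 2 - 4 * (x ^ 2 - c) = (-1) * ((-(2 * x)) ^ 2 - 4 * c) := by ring
    rw [this, map_mul, hm]; ring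
  rw [hS, hK, ← Finset.sum_add_distrib, Finset.mul_sum]
  refine Finset.sum_congr rfl fun b _ => ?_
  rw [← Finset.sum_add_distrib, Finset.mul_sum]
  refine Finset.sum_congr rfl fun c _ => ?_
  ring

/-- The genus 2 curve maps to two elliptic curves. -/
theorem b_split (hF : ringChar F ≠ 2) (w : F) (hw : w ^ 2 = 2) (hpw : quadraticChar F w = 1)
    (hm : quadraticChar F (-1) = 1) :
    ∑ z : F, quadraticChar F (z * (z ^ 2 - 1) * (z ^ 2 - 4)) =
      ∑ u : F, quadraticChar F ((u ^ 2 - 9) * (u + 2 * w)) +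
      ∑ u : F, quadraticChar F ((u ^ 2 - 9) * (u - 2 * w)) := by
  have h2 : (2 : F) ≠ 0 := Ring.two_ne_zero hF
  have hw0 : w ≠ 0 := by rintro rfl; apply h2; rw [← hw]; ring
  have e1 : ∀ z : F, quadraticChar F (z * (z ^ 2 - 1) * (z ^ 2 - 4)) =
      ∑ u : F, if z ^ 2 - u * z + 2 = 0 then quadraticChar F (z * (z ^ 2 - 1) * (z ^ 2 - 4)) else 0 := by
    intro z
    by_cases hz : z = 0
    · simp [hz]
    · have : ∀ u, (z ^ 2 - u * z + 2 = 0) ↔ u = (z ^ 2 + 2) / z := by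
        intro u; rw [eq_div_iff hz]; constructor <;> intro h <;> linear_combination -h
      simp [this]
  simp only [Finset.sum_congr rfl (fun z _ => e1 z)]
  rw [Finset.sum_comm, ← Finset.sum_add_distrib]
  refine Finset.sum_congr rfl fun u _ => ?_
  rw [← Finset.sum_filter]
  have hz0 : ∀ z : F, z ^ 2 - u * z + 2 = 0 → z ≠ 0 := by
    rintro z h rfl; apply h2; simpa using h
  have e2 : ∀ z : F, z ^ 2 - u * z + 2 = 0 →
      quadraticChar F (z * (z ^ 2 - 1) * (z ^ 2 - 4)) =
      quadraticChar F (u ^ 2 - 9) * quadraticChar F z := by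
    intro z h
    have : z * (z ^ 2 - 1) * (z ^ 2 - 4) = z ^ 2 * ((u ^ 2 - 9) * z) := by
      linear_combination z * (z ^ 2 + 2 + u * z) * h
    rw [this, map_mul, quadraticChar_sq_one' (hz0 z h), one_mul, map_mul]
  by_cases hu1 : u = 2 * w
  · have : (Finset.univ.filter fun z : F => z ^ 2 - u * z + 2 = 0) = {w} := by
      ext z
      simp only [Finset.mem_filter, Finset.mem_univ, true_and, Finset.mem_singleton]
      have : z ^ 2 - u * z + 2 = (z - w) ^ 2 := by rw [hu1]; linear_combination -hw
      rw [this, pow_eq_zero_iff two_ne_zero, sub_eq_zero]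
    rw [this, Finset.sum_singleton, e2 w (by rw [hu1]; linear_combination -hw), hpw, map_mul, map_mul]
    have e : u + 2 * w = 2 ^ 2 * w := by rw [hu1]; ring
    rw [e, map_mul, quadraticChar_sq_one' h2, hpw, hu1]; simp
  by_cases hu2 : u = -(2 * w)
  · have : (Finset.univ.filter fun z : F => z ^ 2 - u * z + 2 = 0) = {-w} := by
      ext z
      simp only [Finset.mem_filter, Finset.mem_univ, true_and, Finset.mem_singleton]
      have : z ^ 2 - u * z + 2 = (z + w) ^ 2 := by rw [hu2]; linear_combination -hw
      rw [this, pow_eq_zero_iff two_ne_zero, add_eq_zero_iff_eq_neg]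
    have hmw : quadraticChar F (-w) = 1 := by
      rw [← neg_one_mul, map_mul, hm, hpw, one_mul]
    rw [this, Finset.sum_singleton, e2 (-w) (by rw [hu2]; linear_combination -hw), hmw, map_mul, map_mul]
    have e : u - 2 * w = 2 ^ 2 * (-w) := by rw [hu2]; ring
    rw [e, map_mul, quadraticChar_sq_one' h2, hmw, hu2]; simp
  have hp : u + 2 * w ≠ 0 := fun h => hu2 (by linear_combination h)
  have e3 : ∀ z ∈ (Finset.univ.filter fun z : F => z ^ 2 - u * z + 2 = 0),
      quadraticChar F (z * (z ^ 2 - 1) * (z ^ 2 - 4)) =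
      quadraticChar F (u ^ 2 - 9) * quadraticChar F (u + 2 * w) := by
    intro z h
    simp only [Finset.mem_filter, Finset.mem_univ, true_and] at h
    rw [e2 z h]
    congr 1
    have hz := hz0 z h
    have e : (z + w) ^ 2 = z * (u + 2 * w) := by linear_combination h + hw
    have hne : z + w ≠ 0 := by
      intro h'
      rw [h'] at e
      exact mul_ne_zero hz hp (by rw [← e]; ring)
    have e' := quadraticChar_sq_one' hne
    rw [e, map_mul] at e'
    rcases quadraticChar_dichotomy hz with h1 | h1 <;> rw [h1] at e' ⊢ <;> linarith
  rw [Finset.sum_congr rfl e3, Finset.sum_const, nsmul_eq_mul, b_roots hF]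
  have e4 : u ^ 2 - 4 * 2 = (u + 2 * w) * (u - 2 * w) := by linear_combination 4 * hw
  have e5 := quadraticChar_sq_one hp
  rw [e4, map_mul, map_mul, map_mul]
  linear_combination quadraticChar F (u ^ 2 - 9) * quadraticChar F (u - 2 * w) * e5


open scoped QuadraticAlgebra

/-- The quadratic extension `F(i)`. -/
abbrev bK (F : Type*) [Field F] := QuadraticAlgebra F (-1) 0

noncomputable instance : Fintype (bK F) := Fintype.ofEquiv _ (QuadraticAlgebra.equivProd (-1 : F) 0).symm

theorem bK_sum (f : bK F → ℤ) : ∑ z, f z = ∑ x, ∑ y, f ⟨x, y⟩ := by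
  rw [← Equiv.sum_comp (QuadraticAlgebra.equivProd (-1 : F) 0).symm, Fintype.sum_prod_type]
  rfl

theorem bK_norm (z : bK F) : QuadraticAlgebra.norm z = z.re ^ 2 + z.im ^ 2 := by
  rw [QuadraticAlgebra.norm_def]; ring

theorem bK_sq (hm : quadraticChar F (-1) = -1) (hF : ringChar F ≠ 2) (x y n : F)
    (h : x ^ 2 + y ^ 2 = n ^ 2) : ∃ s t : F, s ^ 2 - t ^ 2 = x ∧ 2 * s * t = y := by
  have h2 : (2 : F) ≠ 0 := Ring.two_ne_zero hF
  by_cases hy : y = 0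
  · subst hy
    by_cases hx : x = 0
    · exact ⟨0, 0, by simp [hx], by simp⟩
    rcases quadraticChar_dichotomy hx with h1 | h1
    · obtain ⟨s, hs⟩ := (quadraticChar_one_iff_isSquare hx).1 h1
      exact ⟨s, 0, by rw [hs]; ring, by ring⟩
    · have : quadraticChar F (-x) = 1 := by rw [← neg_one_mul, map_mul, hm, h1]; norm_num
      obtain ⟨s, hs⟩ := (quadraticChar_one_iff_isSquare (neg_ne_zero.2 hx)).1 this
      exact ⟨0, s, by linear_combination hs, by ring⟩
  · have hprod : (2 * (x + n)) * (2 * (x - n)) = -1 * (2 * y) ^ 2 := by linear_combination 4 * h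
    have hy2 : 2 * y ≠ 0 := mul_ne_zero h2 hy
    have hc := congrArg (quadraticChar F) hprod
    rw [map_mul, map_mul _ (-1 : F), hm, quadraticChar_sq_one' hy2, mul_one] at hc
    have hne : (2 * (x + n)) * (2 * (x - n)) ≠ 0 := by
      rw [hprod]; exact mul_ne_zero (by simp) (pow_ne_zero _ hy2)
    have hfin : ∀ A B : F, A + B = 4 * x → A * B = -1 * (2 * y) ^ 2 → A ≠ 0 →
        quadraticChar F A = 1 → ∃ s t : F, s ^ 2 - t ^ 2 = x ∧ 2 * s * t = y := by
      intro A B hAB hAB' hA h1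
      obtain ⟨s, hs⟩ := (quadraticChar_one_iff_isSquare hA).1 h1
      have hs0 : s ≠ 0 := by rintro rfl; apply hA; rw [hs]; ring
      refine ⟨s / 2, y / s, ?_, by field_simp⟩
      have h4 : (4 : F) ≠ 0 := by
        have : (4 : F) = 2 * 2 := by norm_num
        rw [this]; exact mul_ne_zero h2 h2
      subst hs
      have : B = 4 * x - s * s := by linear_combination hAB
      subst this
      have e : (s / 2) ^ 2 - (y / s) ^ 2 = (s ^ 4 - 4 * y ^ 2) / (4 * s ^ 2) := by
        have h42 : (4 : F) = 2 ^ 2 := by norm_num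
        rw [h42]; field_simp
      rw [e, div_eq_iff (by simp [h4, hs0])]
      linear_combination - hAB'
    rcases quadraticChar_dichotomy (left_ne_zero_of_mul hne) with h1 | h1
    · exact hfin _ _ (by ring) hprod (left_ne_zero_of_mul hne) h1
    · rw [h1] at hc
      exact hfin (2 * (x - n)) (2 * (x + n)) (by ring) (by rw [mul_comm, hprod])
        (right_ne_zero_of_mul hne) (by linarith)

theorem bK_fact (hm : quadraticChar F (-1) = -1) :
    Fact (∀ r : F, r ^ 2 ≠ (-1 : F) + 0 * r) := by
  constructor
  intro r hr
  rw [quadraticChar_neg_one_iff_not_isSquare] at hm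
  exact hm ⟨r, by linear_combination -hr⟩

section
variable [hfact : Fact (∀ r : F, r ^ 2 ≠ (-1 : F) + 0 * r)] [DecidableEq (bK F)]

theorem bK_ringChar (hF : ringChar F ≠ 2) : ringChar (bK F) ≠ 2 := by
  intro h
  have h1 : ((ringChar (bK F) : ℕ) : bK F) = 0 := ringChar.Nat.cast_ringChar
  rw [h] at h1
  have h2 := congrArg QuadraticAlgebra.re h1
  exact Ring.two_ne_zero hF (by simpa using (h2 : ((2 : ℕ) : F) = 0))

theorem bK_char (hF : ringChar F ≠ 2) (hm : quadraticChar F (-1) = -1) (z : bK F) :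
    quadraticChar (bK F) z = quadraticChar F (QuadraticAlgebra.norm z) := by
  by_cases hz : z = 0
  · subst hz; simp
  have hn : QuadraticAlgebra.norm z ≠ 0 := by
    rwa [Ne, QuadraticAlgebra.norm_eq_zero_iff_eq_zero]
  by_cases hs : IsSquare z
  · rw [(quadraticChar_one_iff_isSquare hz).2 hs, eq_comm, quadraticChar_one_iff_isSquare hn]
    obtain ⟨s, rfl⟩ := hs
    exact ⟨QuadraticAlgebra.norm s, map_mul _ _ _⟩
  · rw [quadraticChar_neg_one_iff_not_isSquare.2 hs, eq_comm, quadraticChar_neg_one_iff_not_isSquare]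
    rintro ⟨n, hn'⟩
    rw [bK_norm] at hn'
    obtain ⟨s, t, h1, h2⟩ := bK_sq hm hF z.re z.im n (by rw [hn']; ring)
    apply hs
    refine ⟨⟨s, t⟩, ?_⟩
    ext
    · simp; rw [← h1]; ring
    · simp; rw [← h2]; ring

theorem b_card_ne : ((Fintype.card F : ℤ) - 1) ≠ 0 := by
  have := Fintype.one_lt_card (α := F)
  omega

theorem b_ell (hF : ringChar F ≠ 2) (hm : quadraticChar F (-1) = -1) (h3 : (3 : F) ≠ 0)
    (w : F) (hw : w ^ 2 = 2) (hA : ∑ u : F, quadraticChar F ((u ^ 2 - 9) * (u + 2 * w)) = 0) :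
    ∑ u : bK F, quadraticChar (bK F) ((u ^ 2 - 9) * (u + 2 * ⟨w, 0⟩)) = 2 * Fintype.card F := by
  have h2 : (2 : F) ≠ 0 := Ring.two_ne_zero hF
  have e1 := b_sum4 hF 1 0 3 1 (-3) 1 (-(2 * w)) 1 (by norm_num) (by norm_num)
    (by
      have : (3 * 1 - -3 * 1 : F) = 2 * 3 := by norm_num
      rw [this]; exact mul_ne_zero h2 h3) (by norm_num)
    (by
      intro h
      have : (1 : F) = 0 := by linear_combination (3 - 2 * w) * h + 4 * hw
      exact one_ne_zero this)
    (by
      intro h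
      have : (1 : F) = 0 := by linear_combination (-3 - 2 * w) * h + 4 * hw
      exact one_ne_zero this)
  have e2 := b_scale (F := F) (fun a b c => quadraticChar F (bLn 1 0 (a, b, c) * bLn 3 1 (a, b, c) *
    bLn (-3) 1 (a, b, c) * bLn (-(2 * w)) 1 (a, b, c))) (by intro b c; simp [bLn]) (by
      intro a b c ha
      have : bLn 1 0 (a, a * b, a * c) * bLn 3 1 (a, a * b, a * c) *
        bLn (-3) 1 (a, a * b, a * c) * bLn (-(2 * w)) 1 (a, a * b, a * c) =
        (a ^ 2) ^ 2 * (bLn 1 0 (1, b, c) * bLn 3 1 (1, b, c) *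
          bLn (-3) 1 (1, b, c) * bLn (-(2 * w)) 1 (1, b, c)) := by
        simp only [bLn]; ring
      rw [this, map_mul, quadraticChar_sq_one' (pow_ne_zero _ ha), one_mul])
  simp only [Prod.mk.eta] at e2
  rw [e1, mul_comm] at e2
  have e3 := mul_left_cancel₀ b_card_ne e2
  rw [e3, b_symm hF hm]
  have e4 : ∀ r s : F, quadraticChar F (bLn 1 0 (1, -(r + s), r * s) * bLn 3 1 (1, -(r + s), r * s) *
      bLn (-3) 1 (1, -(r + s), r * s) * bLn (-(2 * w)) 1 (1, -(r + s), r * s)) =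
      quadraticChar F ((r ^ 2 - 9) * (r + 2 * w)) * quadraticChar F ((s ^ 2 - 9) * (s + 2 * w)) := by
    intro r s
    rw [← map_mul]; congr 1; simp only [bLn]; ring
  simp only [e4, ← Finset.mul_sum, hA, mul_zero, Finset.sum_const_zero, zero_add]
  rw [bK_sum]
  refine Finset.sum_congr rfl fun x _ => Finset.sum_congr rfl fun y _ => ?_
  rw [bK_char hF hm, bK_norm]
  congr 1
  simp [bLn, pow_two]
  ring

theorem b_f (hF : ringChar F ≠ 2) (hm : quadraticChar F (-1) = -1) (h3 : (3 : F) ≠ 0)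
    (w : F) (hw : w ^ 2 = 2) (hA : ∑ u : F, quadraticChar F ((u ^ 2 - 9) * (u + 2 * w)) = 0)
    (hA' : ∑ u : F, quadraticChar F ((u ^ 2 - 9) * (u - 2 * w)) = 0) :
    ∑ z : bK F, quadraticChar (bK F) (z * (z ^ 2 - 1) * (z ^ 2 - 4)) = 4 * Fintype.card F := by
  have h2 : (2 : F) ≠ 0 := Ring.two_ne_zero hF
  have hw0 : w ≠ 0 := by rintro rfl; apply h2; rw [← hw]; ring
  have hwK : (⟨w, 0⟩ : bK F) ^ 2 = 2 := by
    rw [pow_two]; ext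
    · simp [← hw]; ring
    · simp
  have c1 : quadraticChar (bK F) ⟨w, 0⟩ = 1 := by
    rw [bK_char hF hm, bK_norm]
    simpa using quadraticChar_sq_one' hw0
  have c2 : quadraticChar (bK F) (-1) = 1 := by
    rw [bK_char hF hm, bK_norm]
    simp
  rw [b_split (bK_ringChar hF) _ hwK c1 c2, b_ell hF hm h3 w hw hA]
  have := b_ell hF hm h3 (-w) (by rw [neg_sq, hw]) (by rw [← hA']; congr! 2; ring)
  have e : (⟨-w, 0⟩ : bK F) = - ⟨w, 0⟩ := by ext <;> simp
  rw [e] at this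
  simp only [mul_neg, ← sub_eq_add_neg] at this
  rw [this]; ring
end

theorem b_six (hF : ringChar F ≠ 2) (hm : quadraticChar F (-1) = -1) (h3 : (3 : F) ≠ 0)
    (w : F) (hw : w ^ 2 = 2) (hA : ∑ u : F, quadraticChar F ((u ^ 2 - 9) * (u + 2 * w)) = 0)
    (hA' : ∑ u : F, quadraticChar F ((u ^ 2 - 9) * (u - 2 * w)) = 0) :
    ∑ v, quadraticChar F (bLn 1 0 v * bLn (-2) 1 v * bLn (-1) 1 v * bLn 0 1 v *
      bLn 1 1 v * bLn 2 1 v) = 2 * (Fintype.card F : ℤ) * (Fintype.card F - 1) := by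
  classical
  have := bK_fact hm
  have e2 := b_scale (F := F) (fun a b c => quadraticChar F (bLn 1 0 (a, b, c) * bLn (-2) 1 (a, b, c) *
    bLn (-1) 1 (a, b, c) * bLn 0 1 (a, b, c) *
      bLn 1 1 (a, b, c) * bLn 2 1 (a, b, c))) (by intro b c; simp [bLn]) (by
      intro a b c ha
      have : bLn 1 0 (a, a * b, a * c) * bLn (-2) 1 (a, a * b, a * c) *
        bLn (-1) 1 (a, a * b, a * c) * bLn 0 1 (a, a * b, a * c) *
        bLn 1 1 (a, a * b, a * c) * bLn 2 1 (a, a * b, a * c) =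
        (a ^ 3) ^ 2 * (bLn 1 0 (1, b, c) * bLn (-2) 1 (1, b, c) *
        bLn (-1) 1 (1, b, c) * bLn 0 1 (1, b, c) *
        bLn 1 1 (1, b, c) * bLn 2 1 (1, b, c)) := by
        simp only [bLn]; ring
      rw [this, map_mul, quadraticChar_sq_one' (pow_ne_zero _ ha), one_mul])
  simp only [Prod.mk.eta] at e2
  rw [e2]
  have e3 := b_symm hF hm (fun b c => quadraticChar F (bLn 1 0 (1, b, c) * bLn (-2) 1 (1, b, c) *
        bLn (-1) 1 (1, b, c) * bLn 0 1 (1, b, c) *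
        bLn 1 1 (1, b, c) * bLn 2 1 (1, b, c)))
  have e4 : ∀ r s : F, quadraticChar F (bLn 1 0 (1, -(r + s), r * s) *
      bLn (-2) 1 (1, -(r + s), r * s) * bLn (-1) 1 (1, -(r + s), r * s) *
      bLn 0 1 (1, -(r + s), r * s) * bLn 1 1 (1, -(r + s), r * s) * bLn 2 1 (1, -(r + s), r * s)) =
      quadraticChar F (r * (r ^ 2 - 1) * (r ^ 2 - 4)) *
        quadraticChar F (s * (s ^ 2 - 1) * (s ^ 2 - 4)) := by
    intro r s
    rw [← map_mul]; congr 1; simp only [bLn]; ring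
  have e5 : ∑ r : F, quadraticChar F (r * (r ^ 2 - 1) * (r ^ 2 - 4)) = 0 := by
    have h : ∑ r : F, quadraticChar F (r * (r ^ 2 - 1) * (r ^ 2 - 4)) =
        - ∑ r : F, quadraticChar F (r * (r ^ 2 - 1) * (r ^ 2 - 4)) := by
      rw [← Finset.sum_neg_distrib]
      conv_lhs => rw [← Equiv.sum_comp (Equiv.neg F)]
      refine Finset.sum_congr rfl fun r _ => ?_
      have : -r * ((-r) ^ 2 - 1) * ((-r) ^ 2 - 4) = -1 * (r * (r ^ 2 - 1) * (r ^ 2 - 4)) := by ring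
      rw [Equiv.neg_apply, this, map_mul, hm, neg_one_mul]
    linarith
  have e6 := b_f hF hm h3 w hw hA hA'
  rw [bK_sum] at e6
  have e7 : ∀ x y : F, quadraticChar (bK F) ((⟨x, y⟩ : bK F) * ((⟨x, y⟩ : bK F) ^ 2 - 1) *
      ((⟨x, y⟩ : bK F) ^ 2 - 4)) =
      quadraticChar F (bLn 1 0 (1, -(2 * x), x ^ 2 + y ^ 2) *
      bLn (-2) 1 (1, -(2 * x), x ^ 2 + y ^ 2) * bLn (-1) 1 (1, -(2 * x), x ^ 2 + y ^ 2) *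
      bLn 0 1 (1, -(2 * x), x ^ 2 + y ^ 2) * bLn 1 1 (1, -(2 * x), x ^ 2 + y ^ 2) *
      bLn 2 1 (1, -(2 * x), x ^ 2 + y ^ 2)) := by
    intro x y
    rw [bK_char hF hm, bK_norm]
    congr 1
    simp [bLn, pow_two]
    ring
  simp only [e7] at e6
  simp only [e4, ← Finset.mul_sum, e5, mul_zero, Finset.sum_const_zero, zero_add, e6] at e3
  have e8 := mul_left_cancel₀ (two_ne_zero' ℤ) (e3.trans (show (4 * Fintype.card F : ℤ) = 2 * (2 * Fintype.card F) by ring))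
  rw [e8]; ring


/-- First homogeneous coordinate of the six points. -/
def bA (F : Type*) [Field F] : Fin 6 → F := ![1, -2, -1, 0, 1, 2]

/-- Second homogeneous coordinate of the six points. -/
def bB (F : Type*) [Field F] : Fin 6 → F := ![0, 1, 1, 1, 1, 1]

/-- The line attached to the `i`-th point. -/
def bL (i : Fin 6) (v : F × F × F) : F := bLn (bA F i) (bB F i) v

theorem b_bracket (hF : ringChar F ≠ 2) (h3 : (3 : F) ≠ 0) (i j : Fin 6) (hij : i ≠ j) :
    bA F i * bB F j - bA F j * bB F i ≠ 0 := by
  have h2 : (2 : F) ≠ 0 := Ring.two_ne_zero hF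
  have h4 : (4 : F) ≠ 0 := by
    have : (4 : F) = 2 * 2 := by norm_num
    rw [this]; exact mul_ne_zero h2 h2
  fin_cases i <;> fin_cases j <;> first
    | exact absurd rfl hij
    | (simp [bA, bB]; done)
    | (simp [bA, bB]; norm_num [h2, h3, h4]; done)

theorem b_T_odd (hF : ringChar F ≠ 2) (S : Finset (Fin 6)) (hS : Odd S.card) :
    ∑ v, ∏ i ∈ S, quadraticChar F (bL i v) = 0 := by
  obtain ⟨n, hn⟩ := quadraticChar_exists_neg_one hF
  have hn0 : n ≠ 0 := by rintro rfl; simp at hn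
  have h : ∑ v, ∏ i ∈ S, quadraticChar F (bL i v) = - ∑ v, ∏ i ∈ S, quadraticChar F (bL i v) := by
    rw [← Finset.sum_neg_distrib]
    conv_lhs => rw [← Equiv.sum_comp ((Equiv.mulLeft₀ n hn0).prodCongr
      ((Equiv.mulLeft₀ n hn0).prodCongr (Equiv.mulLeft₀ n hn0)))]
    refine Finset.sum_congr rfl fun v _ => ?_
    have : ∀ i : Fin 6, quadraticChar F (bL i (((Equiv.mulLeft₀ n hn0).prodCongr
      ((Equiv.mulLeft₀ n hn0).prodCongr (Equiv.mulLeft₀ n hn0))) v)) =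
        (-1) * quadraticChar F (bL i v) := by
      intro i
      rw [← hn, ← map_mul]; congr 1
      simp [bL, bLn]; ring
    rw [Finset.prod_congr rfl (fun i _ => this i), Finset.prod_mul_distrib, Finset.prod_const,
      hS.neg_one_pow, neg_one_mul]
  linarith

theorem b_T_two (hF : ringChar F ≠ 2) (h3 : (3 : F) ≠ 0) (S : Finset (Fin 6)) (hS : S.card = 2) :
    ∑ v, ∏ i ∈ S, quadraticChar F (bL i v) = 0 := by
  obtain ⟨i, j, hij, rfl⟩ := Finset.card_eq_two.1 hS
  obtain ⟨k, hki, hkj⟩ : ∃ k : Fin 6, i ≠ k ∧ j ≠ k := by revert i j; decide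
  simp only [Finset.prod_pair hij, bL]
  rw [b_change3 _ _ _ _ _ _ (b_bracket hF h3 i j hij) (b_bracket hF h3 i k hki)
    (b_bracket hF h3 j k hkj) (fun x y _ => quadraticChar F x * quadraticChar F y)]
  simp only [← Finset.sum_mul, quadraticChar_sum_zero hF]
  simp

theorem b_T_four (hF : ringChar F ≠ 2) (h3 : (3 : F) ≠ 0) (S : Finset (Fin 6)) (hS : S.card = 4) :
    ∑ v, ∏ i ∈ S, quadraticChar F (bL i v) = (Fintype.card F : ℤ) * (Fintype.card F - 1) := by
  obtain ⟨l, T, hl, rfl, hT⟩ := Finset.card_eq_succ.1 hS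
  obtain ⟨i, j, k, hij, hik, hjk, rfl⟩ := Finset.card_eq_three.1 hT
  simp only [Finset.mem_insert, Finset.mem_singleton, not_or] at hl
  obtain ⟨hi, hj, hk⟩ := hl
  rw [← b_sum4 hF _ _ _ _ _ _ _ _ (b_bracket hF h3 i j hij) (b_bracket hF h3 i k hik)
    (b_bracket hF h3 j k hjk) (b_bracket hF h3 i l (Ne.symm hi)) (b_bracket hF h3 j l (Ne.symm hj))
    (b_bracket hF h3 k l (Ne.symm hk))]
  refine Finset.sum_congr rfl fun v _ => ?_
  rw [Finset.prod_insert (by simp [hi, hj, hk]), Finset.prod_insert (by simp [hij, hik]),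
    Finset.prod_pair hjk]
  simp only [map_mul, bL]; ring

theorem b_total (hF : ringChar F ≠ 2) (hm : quadraticChar F (-1) = -1) (h3 : (3 : F) ≠ 0)
    (w : F) (hw : w ^ 2 = 2) (hA : ∑ u : F, quadraticChar F ((u ^ 2 - 9) * (u + 2 * w)) = 0)
    (hA' : ∑ u : F, quadraticChar F ((u ^ 2 - 9) * (u - 2 * w)) = 0) :
    ∑ v : F × F × F, ∏ i, (1 + quadraticChar F (bL i v)) =
      (Fintype.card F : ℤ) ^ 3 + 17 * Fintype.card F * (Fintype.card F - 1) := by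
  simp only [Finset.prod_one_add]
  rw [Finset.sum_comm]
  have key : ∀ S ∈ (Finset.univ : Finset (Fin 6)).powerset,
      ∑ v : F × F × F, ∏ i ∈ S, quadraticChar F (bL i v) =
      (fun n : ℕ => if n = 0 then (Fintype.card F : ℤ) ^ 3 else
        if n = 4 then (Fintype.card F : ℤ) * (Fintype.card F - 1) else
        if n = 6 then 2 * (Fintype.card F : ℤ) * (Fintype.card F - 1) else 0) S.card := by
    intro S _
    have hc : S.card ≤ 6 := by simpa using Finset.card_le_univ S
    obtain ⟨n, hn⟩ : ∃ n, n = S.card := ⟨_, rfl⟩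
    rw [← hn] at hc ⊢
    interval_cases n
    · rw [Finset.card_eq_zero.1 hn.symm]
      simp; ring
    · simpa using b_T_odd hF S (by rw [← hn]; decide)
    · simpa using b_T_two hF h3 S hn.symm
    · simpa using b_T_odd hF S (by rw [← hn]; decide)
    · simpa using b_T_four hF h3 S hn.symm
    · simpa using b_T_odd hF S (by rw [← hn]; decide)
    · have : S = Finset.univ := (Finset.card_eq_iff_eq_univ S).1 (by simpa using hn.symm)
      subst this
      simp only [Fin.prod_univ_six, ← map_mul]
      exact b_six hF hm h3 w hw hA hA'
  rw [Finset.sum_congr rfl key, Finset.sum_powerset_apply_card (fun n : ℕ =>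
        if n = 0 then (Fintype.card F : ℤ) ^ 3 else
        if n = 4 then (Fintype.card F : ℤ) * (Fintype.card F - 1) else
        if n = 6 then 2 * (Fintype.card F : ℤ) * (Fintype.card F - 1) else 0)]
  simp [Finset.sum_range_succ, Nat.choose]
  ring

theorem b_count (hF : ringChar F ≠ 2) :
    ((Finset.univ.filter fun x : Fin 6 → F =>
      x 3 ^ 2 - 2 * x 2 ^ 2 + x 1 ^ 2 = 2 * x 0 ^ 2 ∧
      x 4 ^ 2 - 2 * x 3 ^ 2 + x 2 ^ 2 = 2 * x 0 ^ 2 ∧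
      x 5 ^ 2 - 2 * x 4 ^ 2 + x 3 ^ 2 = 2 * x 0 ^ 2).card : ℤ) =
    ∑ v : F × F × F, ∏ i, (1 + quadraticChar F (bL i v)) := by
  have h2 : (2 : F) ≠ 0 := Ring.two_ne_zero hF
  rw [Finset.card_eq_sum_card_fiberwise (t := Finset.univ)
    (f := fun x : Fin 6 → F => (x 0 ^ 2, (x 4 ^ 2 - x 2 ^ 2) / 2, x 3 ^ 2)) (by intro x _; simp)]
  rw [Nat.cast_sum]
  refine Finset.sum_congr rfl ?_
  rintro ⟨a, b, c⟩ -
  have hset : (Finset.filter (fun x : Fin 6 → F =>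
      (x 0 ^ 2, (x 4 ^ 2 - x 2 ^ 2) / 2, x 3 ^ 2) = (a, b, c))
      (Finset.univ.filter fun x : Fin 6 → F =>
      x 3 ^ 2 - 2 * x 2 ^ 2 + x 1 ^ 2 = 2 * x 0 ^ 2 ∧
      x 4 ^ 2 - 2 * x 3 ^ 2 + x 2 ^ 2 = 2 * x 0 ^ 2 ∧
      x 5 ^ 2 - 2 * x 4 ^ 2 + x 3 ^ 2 = 2 * x 0 ^ 2)) =
      Fintype.piFinset (fun i => {t : F | t ^ 2 = bL i (a, b, c)}.toFinset) := by
    ext x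
    simp only [Finset.mem_filter, Finset.mem_univ, true_and, Fintype.mem_piFinset,
      Set.mem_toFinset, Set.mem_ofPred_eq, Prod.mk.injEq, Fin.forall_fin_succ,
      div_eq_iff h2]
    simp [bL, bLn, bA, bB]
    constructor
    · rintro ⟨⟨e1, e2, e3⟩, e4, e5, e6⟩
      have f2 : x 2 ^ 2 = a + -b + c := mul_left_cancel₀ h2 (by linear_combination e2 - e5 + 2 * e6 + 2 * e4)
      have f4 : x 4 ^ 2 = a + b + c := by linear_combination e5 + f2
      refine ⟨e4, ?_, f2, e6, f4, ?_⟩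
      · linear_combination e1 + 2 * f2 - e6 + 2 * e4
      · linear_combination e3 + 2 * f4 - e6 + 2 * e4
    · rintro ⟨e0, e1, e2, e3, e4, e5⟩
      refine ⟨⟨?_, ?_, ?_⟩, e0, ?_, e3⟩
      · linear_combination e3 - 2 * e2 + e1 - 2 * e0
      · linear_combination e4 - 2 * e3 + e2 - 2 * e0
      · linear_combination e5 - 2 * e4 + e3 - 2 * e0
      · linear_combination e4 - e2
  rw [hset, Fintype.card_piFinset, Nat.cast_prod]
  refine Finset.prod_congr rfl fun i _ => ?_
  rw [quadraticChar_card_sqrts hF, add_comm]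

theorem b_curve (hF : ringChar F ≠ 2) (w : F) (hw : w ^ 2 = 2)
    (h : ((Finset.univ.filter fun q : F × F =>
      q.2 ^ 2 = q.1 ^ 3 - 8 * q.1 ^ 2 - 2 * q.1).card : ℤ) = Fintype.card F) :
    ∑ u : F, quadraticChar F ((u ^ 2 - 9) * (u + 2 * w)) = 0 := by
  have h2 : (2 : F) ≠ 0 := Ring.two_ne_zero hF
  have hw0 : w ≠ 0 := by rintro rfl; apply h2; rw [← hw]; ring
  have e1 : ((Finset.univ.filter fun q : F × F =>
      q.2 ^ 2 = q.1 ^ 3 - 8 * q.1 ^ 2 - 2 * q.1).card : ℤ) =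
      ∑ x : F, (quadraticChar F (x ^ 3 - 8 * x ^ 2 - 2 * x) + 1) := by
    rw [Finset.card_filter, Fintype.sum_prod_type, Nat.cast_sum]
    refine Finset.sum_congr rfl fun x _ => ?_
    rw [← quadraticChar_card_sqrts hF, ← Finset.card_filter]
    congr 2
    ext y
    simp
  rw [e1, Finset.sum_add_distrib] at h
  have e2 : ∑ x : F, quadraticChar F (x ^ 3 - 8 * x ^ 2 - 2 * x) = 0 := by
    simpa using h
  rw [← Equiv.sum_comp ((Equiv.mulLeft₀ w hw0).trans (Equiv.addRight 4))] at e2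
  have e3 : ∀ u : F, quadraticChar F ((((Equiv.mulLeft₀ w hw0).trans (Equiv.addRight 4)) u) ^ 3 -
      8 * (((Equiv.mulLeft₀ w hw0).trans (Equiv.addRight 4)) u) ^ 2 -
      2 * (((Equiv.mulLeft₀ w hw0).trans (Equiv.addRight 4)) u)) =
      quadraticChar F (2 * w) * quadraticChar F ((u ^ 2 - 9) * (u + 2 * w)) := by
    intro u
    rw [← map_mul]; congr 1
    simp
    linear_combination (w * u ^ 3 + 36) * hw
  rw [Finset.sum_congr rfl (fun u _ => e3 u), ← Finset.mul_sum] at e2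
  refine (mul_eq_zero.1 e2).resolve_left ?_
  rw [quadraticChar_eq_zero_iff]
  exact mul_ne_zero h2 hw0

end Buchi


/-- If `p ≡ 23 (mod 24)` is a supersingular prime for the elliptic curve
`E : y² = x³ − 8x² − 2x` (i.e. `E` has exactly `p` affine points over `𝔽_p`),
then the Büchi K3 surface `X₅` has exactly `p² + 18p + 1` points over `𝔽_p`:
the number of nonzero vectors `(x₀,…,x₅) ∈ 𝔽_p⁶` satisfying the three Büchi
quadrics equals `(p − 1)(p² + 18p + 1)`. -/
theorem buchi_K3_point_count_supersingular (p : ℕ) (hp : p.Prime)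
    (hp24 : p % 24 = 23)
    (hss : {q : ZMod p × ZMod p |
      q.2 ^ 2 = q.1 ^ 3 - 8 * q.1 ^ 2 - 2 * q.1}.ncard = p) :
    {x : Fin 6 → ZMod p | x ≠ 0 ∧
      x 3 ^ 2 - 2 * x 2 ^ 2 + x 1 ^ 2 = 2 * x 0 ^ 2 ∧
      x 4 ^ 2 - 2 * x 3 ^ 2 + x 2 ^ 2 = 2 * x 0 ^ 2 ∧
      x 5 ^ 2 - 2 * x 4 ^ 2 + x 3 ^ 2 = 2 * x 0 ^ 2}.ncard
      = (p - 1) * (p ^ 2 + 18 * p + 1) := by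
  haveI : Fact p.Prime := ⟨hp⟩
  have hp2 : p ≠ 2 := by omega
  have hF : ringChar (ZMod p) ≠ 2 := by rwa [ZMod.ringChar_zmod_n]
  have hcard : Fintype.card (ZMod p) = p := ZMod.card p
  have hm : quadraticChar (ZMod p) (-1) = -1 := by
    rw [quadraticChar_neg_one_iff_not_isSquare, FiniteField.isSquare_neg_one_iff, hcard]
    omega
  have h3 : (3 : ZMod p) ≠ 0 := by
    intro h
    have : ((3 : ℕ) : ZMod p) = 0 := by exact_mod_cast h
    rw [ZMod.natCast_eq_zero_iff] at this
    have := Nat.le_of_dvd (by norm_num) this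
    omega
  obtain ⟨w, hw⟩ := (ZMod.exists_sq_eq_two_iff hp2).2 (Or.inr (by omega))
  have hw : w ^ 2 = 2 := by rw [hw]; ring
  have hcur : ((Finset.univ.filter fun q : ZMod p × ZMod p =>
      q.2 ^ 2 = q.1 ^ 3 - 8 * q.1 ^ 2 - 2 * q.1).card : ℤ) = Fintype.card (ZMod p) := by
    rw [hcard]
    have hc : (Finset.univ.filter fun q : ZMod p × ZMod p =>
        q.2 ^ 2 = q.1 ^ 3 - 8 * q.1 ^ 2 - 2 * q.1).card = p := by
      rw [← Set.ncard_coe_finset]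
      refine Eq.trans ?_ hss
      congr 1
      ext q; simp
    exact_mod_cast hc
  have hA := b_curve hF w hw hcur
  have hA' := b_curve hF (-w) (by rw [neg_sq, hw]) hcur
  simp only [mul_neg, ← sub_eq_add_neg] at hA'
  have h1 := (b_count hF).trans (b_total hF hm h3 w hw hA hA')
  rw [hcard] at h1
  have hset : {x : Fin 6 → ZMod p | x ≠ 0 ∧
      x 3 ^ 2 - 2 * x 2 ^ 2 + x 1 ^ 2 = 2 * x 0 ^ 2 ∧
      x 4 ^ 2 - 2 * x 3 ^ 2 + x 2 ^ 2 = 2 * x 0 ^ 2 ∧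
      x 5 ^ 2 - 2 * x 4 ^ 2 + x 3 ^ 2 = 2 * x 0 ^ 2} =
      (((Finset.univ.filter fun x : Fin 6 → ZMod p =>
      x 3 ^ 2 - 2 * x 2 ^ 2 + x 1 ^ 2 = 2 * x 0 ^ 2 ∧
      x 4 ^ 2 - 2 * x 3 ^ 2 + x 2 ^ 2 = 2 * x 0 ^ 2 ∧
      x 5 ^ 2 - 2 * x 4 ^ 2 + x 3 ^ 2 = 2 * x 0 ^ 2).erase 0 : Finset (Fin 6 → ZMod p)) :
        Set (Fin 6 → ZMod p)) := by
    ext x; simp [and_comm]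
  rw [hset, Set.ncard_coe_finset]
  have h0 := Finset.card_erase_add_one (s := Finset.univ.filter fun x : Fin 6 → ZMod p =>
      x 3 ^ 2 - 2 * x 2 ^ 2 + x 1 ^ 2 = 2 * x 0 ^ 2 ∧
      x 4 ^ 2 - 2 * x 3 ^ 2 + x 2 ^ 2 = 2 * x 0 ^ 2 ∧
      x 5 ^ 2 - 2 * x 4 ^ 2 + x 3 ^ 2 = 2 * x 0 ^ 2) (a := 0) (by simp)
  rw [← h0] at h1
  zify [hp.one_le]
  push_cast at h1
  linear_combination h1
end
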